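/- arXiv:2512.10590 — 10 statements merged into one kernel-verified Lean document; each statement's English description precedes it below -/
import Mathlib

section
/- Let G be a finite simple graph admitting a bipartition (X, Y). If G has property (P), then |X| = |Y|; that is, every bipartite graph with property (P) is a balanced bipartite graph. -/
open Matrix SimpleGraph

/-- A finite simple graph `G` has property (P) if there is a real symmetric matrix `A`
whose off-diagonal support is exactly the edge set of `G`, with `det A ≠ 0`, and such that
every principal submatrix obtained by deleting one row/column is singular. -/
def HasPropertyP {V : Type*} [Finite V] (G : SimpleGraph V) : Prop :=
  letI : Fintype V := Fintype.ofFinite V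
  letI : DecidableEq V := Classical.decEq V
  ∃ A : Matrix V V ℝ, A.IsSymm ∧
    (∀ u v : V, u ≠ v → (A u v ≠ 0 ↔ G.Adj u v)) ∧
    A.det ≠ 0 ∧
    ∀ v : V,
      (A.submatrix (fun x : {x : V // x ≠ v} => (x : V))
        (fun x : {x : V // x ≠ v} => (x : V))).det = 0

/-- Every bipartite graph with property (P) is balanced: if `(X, Y)` is a bipartition
of `G` and `G` has property (P), then `|X| = |Y|`. -/
theorem stmt_0 {V : Type*} [Finite V] (G : SimpleGraph V) (X Y : Set V)
    (hdisj : Disjoint X Y) (hunion : X ∪ Y = Set.univ)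
    (hbip : ∀ u v : V, G.Adj u v → (u ∈ X ∧ v ∈ Y) ∨ (u ∈ Y ∧ v ∈ X))
    (hP : HasPropertyP G) : X.ncard = Y.ncard := by
  classical
  letI iF : Fintype V := Fintype.ofFinite V
  letI iD : DecidableEq V := Classical.decEq V
  obtain ⟨A, hs, hA, hdet, hm⟩ := hP
  have hadj : ∀ v, A.adjugate v v = 0 := by
    intro v
    rw [adjugate_apply, twoBlockTriangular_det _ (fun x => x ≠ v)]
    · have h1 : (A.updateRow v (Pi.single v 1)).toSquareBlockProp (fun x => x ≠ v) =
          A.submatrix (fun x : {x : V // x ≠ v} => (x : V))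
            (fun x : {x : V // x ≠ v} => (x : V)) := by
        ext i j
        simp [toSquareBlockProp, updateRow_ne i.2]
      rw [h1]
      have h2 := hm v
      convert zero_mul _
    · intro i hi j hj
      have hi' : i = v := not_not.mp hi
      subst hi'
      simp [hj]
  have hsym : ∀ u v, A.adjugate u v = A.adjugate v u := by
    intro u v
    have h := adjugate_transpose A
    rw [hs.eq] at h
    exact congrFun (congrFun h v) u
  have hsA : ∀ u v, A u v = A v u := fun u v => hs.apply v u
  have hrow : ∀ u, ∑ v, A u v * A.adjugate v u = A.det := by
    intro u
    have h := congrFun (congrFun (mul_adjugate A) u) u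
    simpa [mul_apply] using h
  have hXY : ∀ u, u ∈ X → u ∉ Y := fun u h h' => Set.disjoint_left.mp hdisj h h'
  have hYc : ∀ u, u ∈ X ∨ u ∈ Y := fun u => by
    have : u ∈ X ∪ Y := hunion ▸ Set.mem_univ u
    exact this
  have key : ∀ S T : Set V, (∀ u v, u ∈ S → v ∉ T → u ≠ v → A u v = 0) →
      ∑ u ∈ S.toFinset, ∑ v ∈ T.toFinset, A u v * A.adjugate v u = S.ncard * A.det := by
    intro S T h
    rw [Set.ncard_eq_toFinset_card' S, ← nsmul_eq_mul, ← Finset.sum_const]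
    refine Finset.sum_congr rfl fun u hu => ?_
    rw [← hrow u]
    refine Finset.sum_subset (Finset.subset_univ _) fun v _ hv => ?_
    by_cases e : u = v
    · subst e; rw [hadj, mul_zero]
    · rw [h u v (by simpa using hu) (by simpa using hv) e, zero_mul]
  have k1 := key X Y (fun u v hu hv e => by
    by_contra hne
    rcases hbip u v ((hA u v e).1 hne) with h | h
    · exact hv h.2
    · exact hXY u hu h.1)
  have k2 := key Y X (fun u v hu hv e => by
    by_contra hne
    rcases hbip u v ((hA u v e).1 hne) with h | h
    · exact hXY u h.1 hu
    · exact hv h.2)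
  rw [Finset.sum_comm] at k2
  have k3 : (X.ncard : ℝ) * A.det = Y.ncard * A.det := by
    rw [← k1, ← k2]
    refine Finset.sum_congr rfl fun u _ => Finset.sum_congr rfl fun v _ => ?_
    rw [hsA u v, hsym v u]
  exact_mod_cast mul_right_cancel₀ hdet k3
end

section
/- For every integer k > 0, every k-regular bipartite finite simple graph has property (P). -/
open Matrix SimpleGraph

theorem matching_of_regular {V : Type*} [Fintype V] (G : SimpleGraph V) [DecidableRel G.Adj]
    (k : ℕ) (hk : 0 < k) (hreg : G.IsRegularOfDegree k) (hbip : G.Colorable 2) :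
    ∃ M : G.Subgraph, M.IsPerfectMatching := by
  classical
  obtain ⟨p, q, hpq⟩ := IsBipartite.exists_isBipartiteWith hbip
  refine exists_isPerfectMatching_of_forall_ncard_le hpq fun s => ?_
  set t : Set V := ⋃ x ∈ s, G.neighborSet x with ht
  rw [Set.ncard_eq_toFinset_card', Set.ncard_eq_toFinset_card']
  refine Nat.le_of_mul_le_mul_right ?_ hk
  refine Finset.card_mul_le_card_mul G.Adj (fun a ha => ?_) (fun b hb => ?_)
  · rw [← hreg a, ← card_neighborFinset_eq_degree]
    refine Finset.card_le_card fun x hx => ?_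
    rw [mem_neighborFinset] at hx
    simp only [Finset.mem_bipartiteAbove, Set.mem_toFinset, ht, Set.mem_iUnion]
    exact ⟨⟨a, by simpa using ha, hx⟩, hx⟩
  · rw [← hreg b, ← card_neighborFinset_eq_degree]
    refine Finset.card_le_card fun x hx => ?_
    rw [mem_neighborFinset]
    exact ((Finset.mem_bipartiteBelow _).1 hx).2.symm

theorem det_eq_of_bip {W : Type*} [Fintype W] [DecidableEq W] (B : Matrix W W ℝ)
    (c : W → Fin 2) (h : ∀ i j, B i j ≠ 0 → c i ≠ c j) :
    B.det = (-1) ^ Fintype.card W * B.det := by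
  let s : W → ℝ := fun i => if c i = 0 then 1 else -1
  have hs : ∀ i, s i * s i = 1 := fun i => by
    simp only [s]; split_ifs <;> norm_num
  have e : -B = diagonal s * B * diagonal s := by
    ext i j
    rw [mul_diagonal, diagonal_mul, neg_apply]
    by_cases hB : B i j = 0
    · simp [hB]
    · have := h i j hB
      have : s i * s j = -1 := by
        simp only [s]
        split_ifs <;> first | (exfalso; omega) | norm_num
      linear_combination (-B i j) * this
  have hd : (diagonal s).det * (diagonal s).det = 1 := by
    rw [det_diagonal, ← Finset.prod_mul_distrib]
    simp [hs]
  rw [← det_neg, e, det_mul, det_mul]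
  linear_combination (-B.det) * hd

theorem core {V : Type*} [Fintype V] [DecidableEq V] (G : SimpleGraph V)
    (c : G.Coloring (Fin 2)) (M : G.Subgraph) (hM : M.IsPerfectMatching) :
    ∃ A : Matrix V V ℝ, A.IsSymm ∧
    (∀ u v : V, u ≠ v → (A u v ≠ 0 ↔ G.Adj u v)) ∧
    A.det ≠ 0 ∧
    ∀ v : V,
      (A.submatrix (fun x : {x : V // x ≠ v} => (x : V))
        (fun x : {x : V // x ≠ v} => (x : V))).det = 0 := by
  classical
  rw [Subgraph.isPerfectMatching_iff] at hM
  choose f hf hu using hM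
  have hff : Function.Involutive f := fun v => (hu (f v) v (hf v).symm).symm
  let A : Matrix V V ℝ := fun u v =>
    if M.Adj u v then (Fintype.card V : ℝ) + 1 else if G.Adj u v then 1 else 0
  have hA : ∀ u v, A u v ≠ 0 ↔ G.Adj u v := by
    intro u v
    simp only [A]
    split_ifs with h1 h2
    · exact iff_of_true (by positivity) h1.adj_sub
    · simp [h2]
    · simp [h2]
  have hdet : A.det ≠ 0 := by
    have h1 : (A.submatrix id (hff.toPerm f)).det ≠ 0 := by
      apply det_ne_zero_of_sum_row_lt_diag
      intro v
      have h2 : ‖A.submatrix id (hff.toPerm f) v v‖ = (Fintype.card V : ℝ) + 1 := by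
        have : A v (f v) = (Fintype.card V : ℝ) + 1 := if_pos (hf v)
        simp only [submatrix_apply, id, Function.Involutive.coe_toPerm, this]
        exact Real.norm_of_nonneg (by positivity)
      rw [h2]
      have h3 : ∑ j ∈ Finset.univ.erase v, ‖A.submatrix id (hff.toPerm f) v j‖
          ≤ (Finset.univ.erase v).card • (1 : ℝ) := by
        refine Finset.sum_le_card_nsmul _ _ _ fun j hj => ?_
        have hn : ¬ M.Adj v (f j) := fun h =>
          (Finset.ne_of_mem_erase hj) (hff.injective (hu v _ h))
        change ‖A v (f j)‖ ≤ 1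
        simp only [A, if_neg hn]
        split_ifs <;> simp
      have h4 : ((Finset.univ.erase v).card : ℝ) ≤ Fintype.card V := by
        exact_mod_cast Finset.card_le_univ _
      rw [nsmul_eq_mul, mul_one] at h3
      linarith
    intro h0
    rw [det_permute'] at h1
    simp [h0] at h1
  have hc : ∀ i j, A i j ≠ 0 → c i ≠ c j := fun i j h => c.valid ((hA i j).1 h)
  refine ⟨A, ?_, fun u v _ => hA u v, hdet, fun v => ?_⟩
  · ext u v
    change A v u = A u v
    simp only [A, M.adj_comm v u, G.adj_comm v u]
  · have hV := det_eq_of_bip A c hc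
    have hW := det_eq_of_bip (A.submatrix (fun x : {x : V // x ≠ v} => (x : V))
        (fun x : {x : V // x ≠ v} => (x : V))) (fun x => c x) (fun i j h => hc i j h)
    have hcard : Fintype.card V = Fintype.card {x : V // x ≠ v} + 1 := by
      have : 0 < Fintype.card V := Fintype.card_pos_iff.2 ⟨v⟩
      rw [Fintype.card_subtype_compl, Fintype.card_subtype_eq]
      omega
    have h1 : (-1 : ℝ) ^ Fintype.card V = 1 :=
      mul_right_cancel₀ hdet (by rw [← hV, one_mul])
    rw [hcard, pow_succ] at h1
    have h2 : (-1 : ℝ) ^ Fintype.card {x : V // x ≠ v} = -1 := by linarith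
    rw [h2] at hW
    linarith

/-- For every k > 0, every k-regular bipartite finite simple graph has property (P). -/
theorem stmt_1 {V : Type*} [Fintype V] (G : SimpleGraph V) [DecidableRel G.Adj]
    (k : ℕ) (hk : 0 < k) (hreg : G.IsRegularOfDegree k) (hbip : G.Colorable 2) :
    HasPropertyP G := by
  obtain ⟨M, hM⟩ := matching_of_regular G k hk hreg hbip
  obtain ⟨c⟩ := hbip
  letI : DecidableEq V := Classical.decEq V
  exact @core V (Fintype.ofFinite V) _ G c M hM
end

section
/- Let G be a connected bipartite finite simple graph with at most 8 vertices. Then G has property (P) if and only if G has a perfect matching. -/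
open Matrix SimpleGraph

theorem adjugate_diag_eq {V : Type*} [Fintype V] [DecidableEq V] (A : Matrix V V ℝ) (v : V) :
    A.adjugate v v = (A.submatrix (fun x : {x : V // x ≠ v} => (x : V))
        (fun x : {x : V // x ≠ v} => (x : V))).det := by
  rw [adjugate_apply, twoBlockTriangular_det _ (fun x => x ≠ v)]
  · have h2 : (toSquareBlockProp (A.updateRow v (Pi.single v 1)) fun i => ¬ i ≠ v) = 1 := by
      ext ⟨i, hi⟩ ⟨j, hj⟩
      have hi' : i = v := not_not.mp hi
      have hj' : j = v := not_not.mp hj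
      subst hi'
      subst hj'
      simp [toSquareBlockProp]
    rw [h2, det_one, mul_one]
    congr 1
    ext ⟨i, hi⟩ ⟨j, hj⟩
    simp [toSquareBlockProp, hi]
  · intro i hi j hj
    have hi' : i = v := not_not.mp hi
    subst hi'
    simp [hj]

theorem hasPropertyP_unfold {V : Type*} [Finite V] [i1 : Fintype V] [i2 : DecidableEq V]
    (G : SimpleGraph V) :
    HasPropertyP G ↔ ∃ A : Matrix V V ℝ, A.IsSymm ∧
    (∀ u v : V, u ≠ v → (A u v ≠ 0 ↔ G.Adj u v)) ∧
    A.det ≠ 0 ∧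
    ∀ v : V,
      (A.submatrix (fun x : {x : V // x ≠ v} => (x : V))
        (fun x : {x : V // x ≠ v} => (x : V))).det = 0 := by
  obtain rfl : i1 = Fintype.ofFinite V := Subsingleton.elim _ _
  obtain rfl : i2 = Classical.decEq V := Subsingleton.elim _ _
  exact Iff.rfl

/-- property (P) through the inverse matrix -/
theorem hasPropertyP_iff {V : Type*} [Fintype V] [DecidableEq V] (G : SimpleGraph V) :
    HasPropertyP G ↔ ∃ A C : Matrix V V ℝ, A.IsSymm ∧
    (∀ u v : V, u ≠ v → (A u v ≠ 0 ↔ G.Adj u v)) ∧ A * C = 1 ∧ C.IsSymm ∧ ∀ v, C v v = 0 := by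
  rw [hasPropertyP_unfold]
  constructor
  · rintro ⟨A, hs, ha, hd, hm⟩
    refine ⟨A, A⁻¹, hs, ha, mul_nonsing_inv A (isUnit_iff_ne_zero.mpr hd), ?_, ?_⟩
    · rw [Matrix.IsSymm, transpose_nonsing_inv, hs]
    · intro v
      have := hm v
      rw [inv_def, Matrix.smul_apply, adjugate_diag_eq]
      simp only [smul_eq_mul, mul_eq_zero]
      right
      convert this
  · rintro ⟨A, C, hs, ha, hd, hC, hm⟩
    have hdet : A.det ≠ 0 := by
      intro h
      have := congrArg Matrix.det hd
      rw [det_mul, h] at this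
      simp at this
    refine ⟨A, hs, ha, hdet, ?_⟩
    intro v
    have h1 := inv_eq_right_inv hd
    have h2 := hm v
    rw [← h1, inv_def, Matrix.smul_apply, adjugate_diag_eq] at h2
    simp only [smul_eq_mul, mul_eq_zero] at h2
    rcases h2 with h2 | h2
    · simp [hdet] at h2
    · convert h2

theorem P_of_matching {V : Type*} [Fintype V] [DecidableEq V] (G : SimpleGraph V)
    (c : V → Bool) (hc : ∀ u v, G.Adj u v → c u ≠ c v)
    (M : G.Subgraph) (hM : M.IsPerfectMatching) : HasPropertyP G := by
  classical
  rw [hasPropertyP_iff]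
  rw [Subgraph.isPerfectMatching_iff] at hM
  choose m hm hu using hM
  have hinv : Function.Involutive m := fun v => (hu (m v) v (hm v).symm).symm
  let A : Matrix V V ℝ := fun u v =>
    if v = m u then (Fintype.card V + 1 : ℝ) else if G.Adj u v then 1 else 0
  have hAv : ∀ u v, A u v =
    if v = m u then (Fintype.card V + 1 : ℝ) else if G.Adj u v then 1 else 0 := fun _ _ => rfl
  have hpos : (0 : ℝ) < Fintype.card V + 1 := by positivity
  have hsymm : A.IsSymm := by
    ext u v
    have : u = m v ↔ v = m u := ⟨fun h => by rw [h, hinv], fun h => by rw [h, hinv]⟩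
    simp only [Matrix.transpose_apply, hAv, this, G.adj_comm]
  have hadj : ∀ u v : V, A u v ≠ 0 ↔ G.Adj u v := by
    intro u v
    by_cases h : v = m u
    · simp only [A, h, if_true]
      exact ⟨fun _ => (hm u).adj_sub, fun _ => hpos.ne'⟩
    · simp [A, h]
  have hdet : A.det ≠ 0 := by
    have h1 := det_permute' hinv.toPerm A
    intro h0
    rw [h0, mul_zero] at h1
    refine det_ne_zero_of_sum_row_lt_diag (A := A.submatrix id hinv.toPerm) ?_ h1
    intro k
    have hk : A k (m k) = Fintype.card V + 1 := by simp [A]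
    have hle : ∀ j ∈ Finset.univ.erase k, ‖(A.submatrix id hinv.toPerm) k j‖ ≤ 1 := by
      intro j hj
      have hj' : m j ≠ m k := fun h => (Finset.ne_of_mem_erase hj) (hinv.injective h)
      simp only [submatrix_apply, id, Function.Involutive.coe_toPerm, hAv, hj', if_false]
      split_ifs <;> simp
    have h2 := Finset.sum_le_sum hle
    have h3 : ((Finset.univ.erase k).card : ℝ) ≤ Fintype.card V := by
      exact_mod_cast Finset.card_le_univ _
    simp only [submatrix_apply, id, Function.Involutive.coe_toPerm, hk,
      Finset.sum_const, nsmul_eq_mul, mul_one] at h2 ⊢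
    rw [Real.norm_of_nonneg hpos.le]
    linarith
  have hAC := mul_nonsing_inv A (isUnit_iff_ne_zero.mpr hdet)
  refine ⟨A, A⁻¹, hsymm, fun u v _ => hadj u v, hAC, ?_, ?_⟩
  · rw [Matrix.IsSymm, transpose_nonsing_inv, hsymm]
  · intro v
    let d : V → ℝ := fun x => if c x then 1 else -1
    have hdd : ∀ x, d x * d x = 1 := by
      intro x
      simp only [d]
      split_ifs <;> norm_num
    let J : Matrix V V ℝ := diagonal d
    have hJJ : J * J = 1 := by
      simp only [J, diagonal_mul_diagonal, hdd, diagonal_one]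
    have hJ : A * J = -(J * A) := by
      ext x y
      simp only [J, mul_diagonal, Matrix.neg_apply, diagonal_mul]
      by_cases h : A x y = 0
      · simp [h]
      · have := hc x y ((hadj x y).mp h)
        simp only [d]
        clear_value A
        clear hadj hAv hinv
        cases hx : c x <;> cases hy : c y <;> simp [hx, hy] at this ⊢
    have h1 : A * (-(J * A⁻¹ * J)) = 1 := by
      rw [mul_neg, ← mul_assoc, ← mul_assoc, hJ, neg_mul, neg_mul, neg_neg, mul_assoc J, hAC,
        mul_one, hJJ]
    have h2 := congrFun (congrFun (inv_eq_right_inv h1) v) v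
    simp only [J, Matrix.neg_apply, mul_diagonal, diagonal_mul] at h2
    have h3 := hdd v
    have h4 : d v * A⁻¹ v v * d v = A⁻¹ v v := by
      rw [mul_right_comm, h3, one_mul]
    rw [h4] at h2
    linarith

theorem no_small {V : Type*} [Fintype V] [DecidableEq V] (G : SimpleGraph V)
    (A C : Matrix V V ℝ) (ha : ∀ u v : V, u ≠ v → (A u v ≠ 0 ↔ G.Adj u v))
    (hAC : A * C = 1) (hCs : C.IsSymm) (hC : ∀ v, C v v = 0)
    (S N : Finset V) (hSN : Disjoint S N) (hN : ∀ u ∈ S, ∀ v, G.Adj u v → v ∈ N)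
    (h1 : N.card ≤ 1) (h2 : N.card < S.card) : False := by
  have hz : ∀ u ∈ S, ∀ v, v ≠ u → v ∉ N → A u v = 0 := by
    intro u hu v hv hvN
    by_contra h
    exact hvN (hN u hu v ((ha u v hv.symm).mp h))
  have hrow : ∀ u v, ∑ w, A u w * C w v = if u = v then 1 else 0 := by
    intro u v
    have := congrFun (congrFun hAC u) v
    rwa [Matrix.mul_apply, Matrix.one_apply] at this
  rcases Nat.le_one_iff_eq_zero_or_eq_one.mp h1 with h | h
  · rw [h] at h2
    obtain ⟨u, hu⟩ := Finset.card_pos.mp h2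
    have hN0 := Finset.card_eq_zero.mp h
    have := hrow u u
    rw [Finset.sum_eq_zero] at this
    · simp at this
    · intro w _
      by_cases hw : w = u
      · rw [hw, hC, mul_zero]
      · rw [hz u hu w hw (by simp [hN0]), zero_mul]
  · rw [h] at h2
    obtain ⟨t, ht⟩ := Finset.card_eq_one.mp h
    obtain ⟨u, hu, v, hv, huv⟩ := Finset.one_lt_card.mp h2
    have hne : ∀ x ∈ S, x ≠ t := by
      intro x hx hxt
      exact Finset.disjoint_left.mp hSN hx (by simp [ht, hxt])
    have key : ∀ x ∈ S, ∀ y, A x x * C x y + A x t * C t y = if x = y then 1 else 0 := by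
      intro x hx y
      rw [← hrow x y]
      symm
      apply Fintype.sum_eq_add x t (hne x hx)
      rintro w ⟨hw1, hw2⟩
      rw [hz x hx w hw1 (by simp [ht, hw2]), zero_mul]
    have k1 := key u hu u
    have k2 := key u hu t
    have k3 := key u hu v
    have k4 := key v hv v
    have hut := hne u hu
    rw [if_neg hut, hC t, mul_zero, add_zero] at k2
    rw [if_pos rfl, hC u, mul_zero, zero_add] at k1
    rw [if_pos rfl, hC v, mul_zero, zero_add] at k4
    rw [if_neg huv] at k3
    have hut0 : A u t ≠ 0 := fun h => by simp [h] at k1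
    have hsym : C u t ≠ 0 := by
      rw [← hCs.apply u t]
      exact fun h => by simp [h] at k1
    have hd : A u u = 0 := (mul_eq_zero.mp k2).resolve_right hsym
    rw [hd, zero_mul, zero_add] at k3
    have h0 := (mul_eq_zero.mp k3).resolve_left hut0
    rw [h0, mul_zero] at k4
    exact zero_ne_one k4

theorem balanced {V : Type*} [Fintype V] [DecidableEq V] (G : SimpleGraph V)
    (c : V → Bool) (hc : ∀ u v, G.Adj u v → c u ≠ c v)
    (A C : Matrix V V ℝ) (hA : A.IsSymm) (ha : ∀ u v : V, u ≠ v → (A u v ≠ 0 ↔ G.Adj u v))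
    (hAC : A * C = 1) (hCs : C.IsSymm) (hC : ∀ v, C v v = 0) (k : Bool) :
    (Finset.univ.filter (fun v => c v = k)).card = (Finset.univ.filter (fun v => c v ≠ k)).card := by
  have hrow : ∀ u, ∑ w, A u w * C w u = 1 := by
    intro u
    have := congrFun (congrFun hAC u) u
    rwa [Matrix.mul_apply, Matrix.one_apply, if_pos rfl] at this
  have hz : ∀ u w, c u = c w → A u w * C w u = 0 := by
    intro u w h
    by_cases huw : u = w
    · rw [huw, hC, mul_zero]
    · have : A u w = 0 := by
        by_contra h'
        exact hc u w ((ha u w huw).mp h') h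
      rw [this, zero_mul]
  have e1 : ((Finset.univ.filter (fun v => c v = k)).card : ℝ) =
      ∑ u ∈ Finset.univ.filter (fun v => c v = k), ∑ w ∈ Finset.univ.filter (fun v => c v ≠ k),
        A u w * C w u := by
    rw [Finset.card_eq_sum_ones, Nat.cast_sum]
    refine Finset.sum_congr rfl fun u hu => ?_
    rw [Nat.cast_one, ← hrow u]
    symm
    apply Finset.sum_subset (Finset.subset_univ _)
    intro w _ hw
    apply hz
    simp at hu hw
    rw [hu, hw]
  have e2 : ((Finset.univ.filter (fun v => c v ≠ k)).card : ℝ) =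
      ∑ u ∈ Finset.univ.filter (fun v => c v ≠ k), ∑ w ∈ Finset.univ.filter (fun v => c v = k),
        A u w * C w u := by
    rw [Finset.card_eq_sum_ones, Nat.cast_sum]
    refine Finset.sum_congr rfl fun u hu => ?_
    rw [Nat.cast_one, ← hrow u]
    symm
    apply Finset.sum_subset (Finset.subset_univ _)
    intro w _ hw
    apply hz
    simp at hu hw
    cases hk : k <;> simp_all
  rw [Finset.sum_comm] at e2
  have : ((Finset.univ.filter (fun v => c v = k)).card : ℝ) =
      ((Finset.univ.filter (fun v => c v ≠ k)).card : ℝ) := by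
    rw [e1, e2]
    refine Finset.sum_congr rfl fun u _ => Finset.sum_congr rfl fun w _ => ?_
    rw [hA.apply w u, hCs.apply w u]
  exact_mod_cast this

theorem side_hall {V : Type*} [Fintype V] [DecidableEq V] (G : SimpleGraph V)
    [DecidableRel G.Adj]
    (c : V → Bool) (hc : ∀ u v, G.Adj u v → c u ≠ c v) (hcard : Fintype.card V ≤ 8)
    (A C : Matrix V V ℝ) (hA : A.IsSymm) (ha : ∀ u v : V, u ≠ v → (A u v ≠ 0 ↔ G.Adj u v))
    (hAC : A * C = 1) (hCs : C.IsSymm) (hC : ∀ v, C v v = 0) (k : Bool)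
    (S : Finset V) (hS : ∀ v ∈ S, c v = k) :
    S.card ≤ (S.biUnion fun v => G.neighborFinset v).card := by
  by_contra! hlt
  set N := S.biUnion fun v => G.neighborFinset v with hNdef
  have hNmem : ∀ v, v ∈ N ↔ ∃ u ∈ S, G.Adj u v := by
    intro v
    simp [hNdef]
  have hNc : ∀ v ∈ N, c v ≠ k := by
    intro v hv
    obtain ⟨u, hu, huv⟩ := (hNmem v).mp hv
    have := hc u v huv
    rw [hS u hu] at this
    exact this.symm
  have hbal := balanced G c hc A C hA ha hAC hCs hC k
  have htot := Finset.card_filter_add_card_filter_not (s := (Finset.univ : Finset V))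
    (fun v => c v = k)
  rw [Finset.card_univ] at htot
  set X := Finset.univ.filter (fun v => c v = k) with hX
  set Y := Finset.univ.filter (fun v => c v ≠ k) with hY
  have hSX : S ⊆ X := fun v hv => by simp [hX, hS v hv]
  have hNY : N ⊆ Y := fun v hv => by simp [hY, hNc v hv]
  have hYX : Disjoint X Y := Finset.disjoint_filter_filter_not _ _ _
  have hSX' := Finset.card_le_card hSX
  have hNY' := Finset.card_le_card hNY
  have hY4 : X.card + Y.card ≤ 8 := le_trans (le_of_eq htot) hcard
  by_cases hN1 : N.card ≤ 1
  · exact no_small G A C ha hAC hCs hC S N (hYX.mono hSX hNY)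
      (fun u hu v huv => (hNmem v).mpr ⟨u, hu, huv⟩) hN1 hlt
  · have c1 := Finset.card_sdiff_of_subset hSX
    have c2 := Finset.card_sdiff_of_subset hNY
    refine no_small G A C ha hAC hCs hC (Y \ N) (X \ S)
      (hYX.symm.mono Finset.sdiff_subset Finset.sdiff_subset) ?_ (by omega) (by omega)
    intro u hu v huv
    rw [Finset.mem_sdiff] at hu ⊢
    have hu1 : c u ≠ k := by simpa [hY] using hu.1
    constructor
    · have := hc u v huv
      simp only [hX, Finset.mem_filter, Finset.mem_univ, true_and]
      exact (Bool.eq_not_of_ne this.symm).trans (by rw [Bool.eq_not_of_ne hu1, Bool.not_not])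
    · intro hv
      exact hu.2 ((hNmem u).mpr ⟨v, hv, huv.symm⟩)

theorem matching_of_P {V : Type*} [Fintype V] [DecidableEq V] (G : SimpleGraph V)
    (c : V → Bool) (hc : ∀ u v, G.Adj u v → c u ≠ c v) (hcard : Fintype.card V ≤ 8)
    (hP : HasPropertyP G) : ∃ M : G.Subgraph, M.IsPerfectMatching := by
  classical
  obtain ⟨A, C, hA, ha, hAC, hCs, hC⟩ := (hasPropertyP_iff G).mp hP
  have hb : G.IsBipartiteWith {v | c v = true} {v | c v = false} := by
    refine ⟨?_, ?_⟩
    · rw [Set.disjoint_left]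
      intro v hv hv'
      simp_all
    · intro u v huv
      have := hc u v huv
      cases hu : c u <;> cases hv : c v <;> simp_all
  refine exists_isPerfectMatching_of_forall_ncard_le hb ?_
  intro s
  have hs : (s.toFinset : Set V) = s := Set.coe_toFinset s
  have hu : (⋃ x ∈ s, G.neighborSet x) =
      ((s.toFinset.biUnion fun v => G.neighborFinset v : Finset V) : Set V) := by
    ext x
    simp
  rw [hu, Set.ncard_coe_finset, ← hs, Set.ncard_coe_finset, hs]
  set S := s.toFinset
  have h1 := side_hall G c hc hcard A C hA ha hAC hCs hC true (S.filter fun v => c v = true)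
    (by simp)
  have h2 := side_hall G c hc hcard A C hA ha hAC hCs hC false (S.filter fun v => ¬ c v = true)
    (by simp)
  have h3 := Finset.card_filter_add_card_filter_not (s := S) (fun v => c v = true)
  rw [← h3]
  refine (Nat.add_le_add h1 h2).trans ?_
  rw [← Finset.card_union_of_disjoint]
  · rw [← Finset.union_biUnion, Finset.filter_union_filter_not_eq]
  · rw [Finset.disjoint_left]
    intro x hx hx'
    simp only [Finset.mem_biUnion, Finset.mem_filter, mem_neighborFinset] at hx hx'
    obtain ⟨u, ⟨_, hu⟩, hux⟩ := hx
    obtain ⟨w, ⟨_, hw⟩, hwx⟩ := hx'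
    have a1 := hc u x hux
    have a2 := hc w x hwx
    cases hxx : c x <;> simp_all

/-- A connected bipartite graph on at most 8 vertices has property (P)
iff it has a perfect matching. -/
theorem stmt_2 {V : Type*} [Fintype V] (G : SimpleGraph V)
    (hconn : G.Connected) (hbip : G.Colorable 2) (hcard : Fintype.card V ≤ 8) :
    HasPropertyP G ↔ ∃ M : G.Subgraph, M.IsPerfectMatching := by
  classical
  obtain ⟨col⟩ := hbip
  let c : V → Bool := fun v => decide (col v = 0)
  have hc : ∀ u v, G.Adj u v → c u ≠ c v := by
    intro u v huv
    have := col.valid huv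
    simp only [c, ne_eq, decide_eq_decide]
    revert this
    generalize col u = a
    generalize col v = b
    revert a b
    decide
  constructor
  · exact matching_of_P G c hc hcard
  · rintro ⟨M, hM⟩
    exact P_of_matching G c hc M hM
end

section
/- Let k be a natural number and let G be a connected bipartite finite simple graph with exactly 8 + 2k vertices that has at least k pendant edges. Then G has property (P) if and only if G has a perfect matching. -/
open Matrix SimpleGraph

/-- Instance-free reformulation. -/
theorem hasP_iff {V : Type*} [i1 : Fintype V] [i2 : DecidableEq V] (G : SimpleGraph V) :
    HasPropertyP G ↔ ∃ A : Matrix V V ℝ, A.IsSymm ∧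
    (∀ u v : V, u ≠ v → (A u v ≠ 0 ↔ G.Adj u v)) ∧
    A.det ≠ 0 ∧
    ∀ v : V,
      (A.submatrix (fun x : {x : V // x ≠ v} => (x : V))
        (fun x : {x : V // x ≠ v} => (x : V))).det = 0 := by
  obtain rfl : i2 = Classical.decEq V := Subsingleton.elim _ _
  unfold HasPropertyP
  generalize Fintype.ofFinite V = i3
  obtain rfl : i3 = i1 := Subsingleton.elim _ _
  rfl

theorem inv_diag_zero {V : Type*} [Fintype V] [DecidableEq V] (A : Matrix V V ℝ)
    (hdet : A.det ≠ 0) (v : V)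
    (h : (A.submatrix (fun x : {x : V // x ≠ v} => (x : V))
        (fun x : {x : V // x ≠ v} => (x : V))).det = 0) : A⁻¹ v v = 0 := by
  obtain ⟨y, hy0, hy⟩ := Matrix.exists_mulVec_eq_zero_iff.mpr h
  set z : V → ℝ := fun x => if hx : x ≠ v then y ⟨x, hx⟩ else 0 with hz
  have hzv : z v = 0 := by simp [hz]
  have hzz : ∀ x : {x : V // x ≠ v}, z x = y x := by
    intro x; simp [hz, x.2]
  have hsum : ∀ x, (A *ᵥ z) x = ∑ w : {x : V // x ≠ v}, A x w * y w := by
    intro x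
    simp only [Matrix.mulVec, dotProduct]
    have e := Finset.sum_subtype (F := inferInstance) (Finset.univ.filter (fun x => x ≠ v)) (p := fun x => x ≠ v)
      (by simp) (fun w => A x w * z w)
    simp only [hzz] at e
    rw [← e]
    symm
    apply Finset.sum_subset (Finset.subset_univ _)
    intro w _ hw
    have hw : w = v := by simpa using hw
    rw [hw, hzv, mul_zero]
  have hAz : A *ᵥ z = Pi.single v ((A *ᵥ z) v) := by
    ext x
    by_cases hx : x = v
    · subst hx; simp
    · rw [Pi.single_eq_of_ne hx, hsum]
      exact congrFun hy ⟨x, hx⟩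
  have hu : IsUnit A.det := isUnit_iff_ne_zero.mpr hdet
  have hz2 : z = A⁻¹ *ᵥ Pi.single v ((A *ᵥ z) v) := by
    rw [← hAz, Matrix.mulVec_mulVec, Matrix.nonsing_inv_mul _ hu, Matrix.one_mulVec]
  have h3 := congrFun hz2 v
  rw [hzv] at h3
  simp at h3
  rcases h3 with h3 | h3
  · exact h3
  · exfalso
    rw [h3] at hz2
    simp at hz2
    apply hy0
    ext x
    rw [← hzz x, hz2]; rfl

theorem comb {V : Type*} [Fintype V] [DecidableEq V] (G : SimpleGraph V) (c : V → Fin 2)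
    (hc : ∀ x y, G.Adj x y → c x ≠ c y) {I : Type*} [Fintype I]
    (p : Fin 2 → I → V) (hpc : ∀ s i, c (p s i) = s) (hpi : ∀ s, Function.Injective (p s))
    (hpa : ∀ i, G.Adj (p 0 i) (p 1 i))
    (hbal : (Finset.univ.filter (fun x => c x = 0)).card =
      (Finset.univ.filter (fun x => c x = 1)).card)
    (h4 : (Finset.univ.filter (fun x => c x = 0)).card ≤ 4 + Fintype.card I)
    (F1 : ∀ x, (∀ s i, x ≠ p s i) → ∃ w, (∀ s i, w ≠ p s i) ∧ G.Adj x w)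
    (F2 : ∀ x y z, x ≠ y → (∀ s i, x ≠ p s i) → (∀ s i, y ≠ p s i) → (∀ s i, z ≠ p s i) →
      (∀ w, (∀ s i, w ≠ p s i) → G.Adj x w → w = z) →
      (∀ w, (∀ s i, w ≠ p s i) → G.Adj y w → w = z) → False) :
    ∃ M : G.Subgraph, M.IsPerfectMatching := by
  classical
  set B : Fin 2 → Finset V := fun s => Finset.univ.filter (fun x => c x = s ∧ ∀ s i, x ≠ p s i)
    with hB
  have memB : ∀ s x, x ∈ B s ↔ c x = s ∧ ∀ s i, x ≠ p s i := by intro s x; simp [hB]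
  have cardB : ∀ s, (B s).card + Fintype.card I =
      (Finset.univ.filter (fun x => c x = s)).card := by
    intro s
    have : (Finset.univ.filter (fun x => c x = s)) = B s ∪ Finset.univ.image (p s) := by
      ext x
      simp only [Finset.mem_filter, Finset.mem_univ, true_and, Finset.mem_union, memB,
        Finset.mem_image]
      constructor
      · intro h
        by_cases hx : ∃ i, p s i = x
        · exact Or.inr hx
        · refine Or.inl ⟨h, fun t i hti => hx ⟨i, ?_⟩⟩
          have : t = s := by rw [← h, hti, hpc]
          rw [← this, hti]
      · rintro (h | ⟨i, rfl⟩)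
        · exact h.1
        · exact hpc _ _
    rw [this, Finset.card_union_of_disjoint, Finset.card_image_of_injective _ (hpi s),
      Finset.card_univ]
    rw [Finset.disjoint_left]
    intro x hx hx'
    obtain ⟨i, -, hi⟩ := Finset.mem_image.mp hx'
    exact ((memB _ _).mp hx).2 s i hi.symm
  have hB0 := cardB 0
  have hB1 := cardB 1
  have c01 : ∀ x y, G.Adj x y → c x = 0 → c y = 1 := by
    intro x y h h'; have := hc x y h; omega
  have c10 : ∀ x y, G.Adj x y → c x = 1 → c y = 0 := by
    intro x y h h'; have := hc x y h; omega
  set t : B 0 → Finset V := fun x => (B 1).filter (fun y => G.Adj x y) with ht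
  have hall : ∀ s : Finset (B 0), s.card ≤ (s.biUnion t).card := by
    intro X
    by_contra hlt
    push Not at hlt
    set N := X.biUnion t with hN
    have hNB : N ⊆ B 1 := by
      intro y hy
      simp only [hN, ht, Finset.mem_biUnion, Finset.mem_filter] at hy
      obtain ⟨_, _, h, _⟩ := hy
      exact h
    have hNmem : ∀ x ∈ X, ∀ w, (∀ s i, w ≠ p s i) → G.Adj x w → w ∈ N := by
      intro x hx w hw hadj
      simp only [hN, ht, Finset.mem_biUnion, Finset.mem_filter]
      exact ⟨x, hx, (memB _ _).mpr ⟨c01 _ _ hadj ((memB _ _).mp x.2).1, hw⟩, hadj⟩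
    have hXne : 0 < X.card := by omega
    obtain ⟨x0, hx0⟩ := Finset.card_pos.mp hXne
    have hN1 : 0 < N.card := by
      obtain ⟨w, hw, hadj⟩ := F1 x0 ((memB _ _).mp x0.2).2
      exact Finset.card_pos.mpr ⟨w, hNmem x0 hx0 w hw hadj⟩
    have hN2 : 2 ≤ N.card := by
      by_contra hn
      have h1 : N.card = 1 := by omega
      obtain ⟨z, hz⟩ := Finset.card_eq_one.mp h1
      obtain ⟨x, hx, y, hy, hxy⟩ := Finset.one_lt_card.mp (show 1 < X.card by omega)
      have hzB : z ∈ B 1 := hNB (by simp [hz])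
      refine F2 x y z (fun h => hxy (Subtype.ext h)) ((memB _ _).mp x.2).2 ((memB _ _).mp y.2).2
        ((memB _ _).mp hzB).2 ?_ ?_
      · intro w hw hadj
        simpa [hz] using hNmem x hx w hw hadj
      · intro w hw hadj
        simpa [hz] using hNmem y hy w hw hadj
    set X' := X.map (Function.Embedding.subtype _) with hX'
    have hX'B : X' ⊆ B 0 := by
      intro x hx
      simp only [hX', Finset.mem_map] at hx
      obtain ⟨x', _, rfl⟩ := hx
      exact x'.2
    have hX'c : X'.card = X.card := Finset.card_map _
    have e1 := Finset.card_sdiff_add_card_eq_card hX'B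
    have e2 := Finset.card_sdiff_add_card_eq_card hNB
    have hback : ∀ y ∈ B 1 \ N, ∀ w, (∀ s i, w ≠ p s i) → G.Adj y w → w ∈ B 0 \ X' := by
      intro y hy w hw hadj
      rw [Finset.mem_sdiff] at hy ⊢
      refine ⟨(memB _ _).mpr ⟨c10 _ _ hadj ((memB _ _).mp hy.1).1, hw⟩, fun hwX => hy.2 ?_⟩
      simp only [hX', Finset.mem_map] at hwX
      obtain ⟨w', hw', rfl⟩ := hwX
      exact hNmem w' hw' y ((memB _ _).mp hy.1).2 hadj.symm
    have mem2 : ∀ y ∈ B 1 \ N, ∀ s i, y ≠ p s i := fun y hy =>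
      ((memB _ _).mp (Finset.mem_sdiff.mp hy).1).2
    have hR : 0 < (B 1 \ N).card := by omega
    have hL0 : 0 < (B 0 \ X').card := by
      obtain ⟨y, hy⟩ := Finset.card_pos.mp hR
      obtain ⟨w, hw, hadj⟩ := F1 y (mem2 y hy)
      exact Finset.card_pos.mpr ⟨w, hback y hy w hw hadj⟩
    have hL1 : (B 0 \ X').card = 1 := by omega
    obtain ⟨z, hz⟩ := Finset.card_eq_one.mp hL1
    have hzB : z ∈ B 0 := (Finset.mem_sdiff.mp (show z ∈ B 0 \ X' by simp [hz])).1
    obtain ⟨x, hx, y, hy, hxy⟩ := Finset.one_lt_card.mp (show 1 < (B 1 \ N).card by omega)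
    refine F2 x y z hxy (mem2 x hx) (mem2 y hy) ((memB _ _).mp hzB).2 ?_ ?_
    · intro w hw hadj
      simpa [hz] using hback x hx w hw hadj
    · intro w hw hadj
      simpa [hz] using hback y hy w hw hadj
  obtain ⟨g, gi, hg⟩ := (Finset.all_card_le_biUnion_card_iff_exists_injective t).mp hall
  have hg' : ∀ x, g x ∈ B 1 ∧ G.Adj x (g x) := fun x => by simpa [ht] using hg x
  have gsurj : ∀ y ∈ B 1, ∃ x, g x = y := by
    have hs : Finset.univ.image g = B 1 := by
      apply Finset.eq_of_subset_of_card_le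
      · intro y hy
        obtain ⟨x, _, rfl⟩ := Finset.mem_image.mp hy
        exact (hg' x).1
      · rw [Finset.card_image_of_injective _ gi, Finset.card_univ, Fintype.card_coe]
        omega
    intro y hy
    rw [← hs] at hy
    obtain ⟨x, _, h⟩ := Finset.mem_image.mp hy
    exact ⟨x, h⟩
  let r : V → V → Prop := fun x y => (∃ i, x = p 0 i ∧ y = p 1 i) ∨ ∃ z : B 0, x = z ∧ y = g z
  have hrG : ∀ x y, r x y → G.Adj x y := by
    rintro x y (⟨i, rfl, rfl⟩ | ⟨z, rfl, rfl⟩)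
    · exact hpa i
    · exact (hg' z).2
  have r0 : ∀ x y, r x y → c x = 0 := by
    rintro x y (⟨i, rfl, rfl⟩ | ⟨z, rfl, rfl⟩)
    · exact hpc _ _
    · exact ((memB _ _).mp z.2).1
  have r1 : ∀ x y, r x y → c y = 1 := fun x y h => c01 x y (hrG x y h) (r0 x y h)
  have uni : ∀ x y y', r x y → r x y' → y = y' := by
    rintro x y y' (⟨i, rfl, rfl⟩ | ⟨z, rfl, rfl⟩) (⟨j, h, rfl⟩ | ⟨w, h, rfl⟩)
    · rw [hpi 0 h]
    · exact (((memB _ _).mp w.2).2 0 i h.symm).elim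
    · exact (((memB _ _).mp z.2).2 0 j h).elim
    · rw [Subtype.ext h]
  have uni' : ∀ x x' y, r x y → r x' y → x = x' := by
    rintro x x' y (⟨i, rfl, rfl⟩ | ⟨z, rfl, rfl⟩) (⟨j, rfl, h⟩ | ⟨w, rfl, h⟩)
    · rw [hpi 1 h]
    · exact (((memB _ _).mp (hg' w).1).2 1 i h.symm).elim
    · exact (((memB _ _).mp (hg' z).1).2 1 j h).elim
    · rw [gi h]
  refine ⟨⟨Set.univ, fun x y => r x y ∨ r y x, ?_, fun _ => Set.mem_univ _, ?_⟩, ?_⟩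
  · rintro x y (h | h)
    · exact hrG _ _ h
    · exact (hrG _ _ h).symm
  · exact ⟨fun x y h => Or.symm h⟩
  · rw [Subgraph.isPerfectMatching_iff]
    intro x
    show ∃! y, r x y ∨ r y x
    have hx : c x = 0 ∨ c x = 1 := by omega
    rcases hx with hx | hx
    · have hex : ∃ y, r x y := by
        by_cases hP : ∀ s i, x ≠ p s i
        · exact ⟨_, Or.inr ⟨⟨x, (memB _ _).mpr ⟨hx, hP⟩⟩, rfl, rfl⟩⟩
        · push Not at hP
          obtain ⟨s, i, h⟩ := hP
          have : s = 0 := by rw [← hx, h, hpc]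
          subst this
          exact ⟨_, Or.inl ⟨i, h, rfl⟩⟩
      obtain ⟨y, hy⟩ := hex
      refine ⟨y, Or.inl hy, ?_⟩
      rintro w (hw | hw)
      · exact uni _ _ _ hw hy
      · have := r1 _ _ hw; omega
    · have hex : ∃ y, r y x := by
        by_cases hP : ∀ s i, x ≠ p s i
        · obtain ⟨z, hz⟩ := gsurj x ((memB _ _).mpr ⟨hx, hP⟩)
          exact ⟨_, Or.inr ⟨z, rfl, hz.symm⟩⟩
        · push Not at hP
          obtain ⟨s, i, h⟩ := hP
          have : s = 1 := by rw [← hx, h, hpc]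
          subst this
          exact ⟨_, Or.inl ⟨i, rfl, h⟩⟩
      obtain ⟨y, hy⟩ := hex
      refine ⟨y, Or.inr hy, ?_⟩
      rintro w (hw | hw)
      · have := r0 _ _ hw; omega
      · exact uni' _ _ _ hw hy

section LinAlg
variable {V : Type*} [Fintype V] [DecidableEq V]

theorem fact1 (A M : Matrix V V ℝ) (hAM : A * M = 1) (hM : ∀ v, M v v = 0) (x : V)
    (h : ∀ y, A x y ≠ 0 → y = x ∨ M y x = 0) : False := by
  have h1 : (A * M) x x = 1 := by rw [hAM]; simp
  rw [Matrix.mul_apply, Finset.sum_eq_zero] at h1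
  · norm_num at h1
  · intro y _
    by_cases hA : A x y = 0
    · simp [hA]
    · rcases h y hA with rfl | h
      · simp [hM]
      · simp [h]

theorem row_expand (A M : Matrix V V ℝ) (hAM : A * M = 1) (x z : V) (hxz : x ≠ z) (q : V)
    (h : ∀ w, A x w ≠ 0 → w = x ∨ w = z ∨ M w q = 0) :
    A x x * M x q + A x z * M z q = (1 : Matrix V V ℝ) x q := by
  rw [← hAM, Matrix.mul_apply, ← Finset.sum_pair hxz (f := fun w => A x w * M w q)]
  apply Finset.sum_subset (Finset.subset_univ _)
  intro w _ hw
  simp only [Finset.mem_insert, Finset.mem_singleton, not_or] at hw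
  by_cases hA : A x w = 0
  · simp [hA]
  · rcases h w hA with h | h | h
    · exact (hw.1 h).elim
    · exact (hw.2 h).elim
    · simp [h]

theorem fact2a (A M : Matrix V V ℝ) (hAM : A * M = 1) (hMs : ∀ x y, M x y = M y x)
    (hM : ∀ v, M v v = 0) (x z : V) (hxz : x ≠ z)
    (h : ∀ w, A x w ≠ 0 → w = x ∨ w = z ∨ (M w x = 0 ∧ M w z = 0)) :
    A x x = 0 ∧ A x z * M z x = 1 := by
  have e1 := row_expand A M hAM x z hxz x (fun w hw => by have := h w hw; tauto)
  have e2 := row_expand A M hAM x z hxz z (fun w hw => by have := h w hw; tauto)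
  rw [hM] at e1 e2
  simp [hxz] at e1 e2
  refine ⟨?_, e1⟩
  rcases e2 with e2 | e2
  · exact e2
  · rw [hMs z x, e2] at e1; norm_num at e1

theorem fact2 (A M : Matrix V V ℝ) (hAM : A * M = 1) (hMs : ∀ x y, M x y = M y x)
    (hM : ∀ v, M v v = 0) (x y z : V) (hxy : x ≠ y) (hxz : x ≠ z) (hyz : y ≠ z)
    (h : ∀ w, A x w ≠ 0 → w = x ∨ w = z ∨ (M w x = 0 ∧ M w y = 0 ∧ M w z = 0))
    (h' : ∀ w, A y w ≠ 0 → w = y ∨ w = z ∨ (M w x = 0 ∧ M w y = 0 ∧ M w z = 0)) : False := by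
  obtain ⟨a1, a2⟩ := fact2a A M hAM hMs hM x z hxz (fun w hw => by have := h w hw; tauto)
  obtain ⟨b1, b2⟩ := fact2a A M hAM hMs hM y z hyz (fun w hw => by have := h' w hw; tauto)
  have e := row_expand A M hAM x z hxz y (fun w hw => by have := h w hw; tauto)
  rw [a1] at e
  simp [hxy] at e
  rcases e with e | e
  · rw [e] at a2; norm_num at a2
  · rw [e] at b2; norm_num at b2

theorem balance (A M : Matrix V V ℝ) (hAM : A * M = 1) (hAs : ∀ x y, A x y = A y x)
    (hMs : ∀ x y, M x y = M y x)
    (hM : ∀ v, M v v = 0) (c : V → Fin 2) (hc : ∀ x y, x ≠ y → A x y ≠ 0 → c x ≠ c y) :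
    (Finset.univ.filter (fun x => c x = 0)).card =
      (Finset.univ.filter (fun x => c x = 1)).card := by
  have key : ∀ s s' : Fin 2, s ≠ s' → ((Finset.univ.filter (fun x => c x = s)).card : ℝ) =
      ∑ x ∈ Finset.univ.filter (fun x => c x = s), ∑ y ∈ Finset.univ.filter (fun x => c x = s'),
        A x y * M y x := by
    intro s s' hss
    have : ∀ x ∈ Finset.univ.filter (fun x => c x = s),
        ∑ y ∈ Finset.univ.filter (fun x => c x = s'), A x y * M y x = 1 := by
      intro x hx
      have hx : c x = s := by simpa using hx
      have h1 : (A * M) x x = 1 := by rw [hAM]; simp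
      rw [← h1, Matrix.mul_apply]
      apply Finset.sum_subset (Finset.subset_univ _)
      intro y _ hy
      have hy : c y ≠ s' := by simpa using hy
      by_cases hxy : x = y
      · subst hxy; simp [hM]
      · by_cases hA : A x y = 0
        · simp [hA]
        · have := hc x y hxy hA
          omega
    rw [Finset.sum_congr rfl this]; simp
  have : ((Finset.univ.filter (fun x => c x = 0)).card : ℝ) =
      (Finset.univ.filter (fun x => c x = 1)).card := by
    rw [key 0 1 (by decide), key 1 0 (by decide), Finset.sum_comm]
    refine Finset.sum_congr rfl fun x _ => Finset.sum_congr rfl fun y _ => ?_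
    rw [hAs, hMs]
  exact_mod_cast this

end LinAlg

theorem forward {V : Type*} [Fintype V] [DecidableEq V] (G : SimpleGraph V) [DecidableRel G.Adj]
    (k : ℕ) (c : V → Fin 2) (hc : ∀ x y, G.Adj x y → c x ≠ c y)
    (hcard : Fintype.card V = 8 + 2 * k)
    (hpend : k ≤ {e : Sym2 V | e ∈ G.edgeSet ∧ ∃ v ∈ e, G.degree v = 1}.ncard)
    (A M : Matrix V V ℝ) (hAM : A * M = 1) (hAs : ∀ x y, A x y = A y x)
    (hMs : ∀ x y, M x y = M y x) (hM : ∀ v, M v v = 0)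
    (hA : ∀ u v : V, u ≠ v → (A u v ≠ 0 ↔ G.Adj u v)) :
    ∃ M : G.Subgraph, M.IsPerfectMatching := by
  classical
  have hAadj : ∀ x w, A x w ≠ 0 → w = x ∨ G.Adj x w := by
    intro x w h
    by_cases hx : w = x
    · exact Or.inl hx
    · exact Or.inr ((hA x w (Ne.symm hx)).mp h)
  have hbal := balance A M hAM hAs hMs hM c (fun x y hxy h => hc x y ((hA x y hxy).mp h))
  have htot : (Finset.univ.filter (fun x => c x = 0)).card +
      (Finset.univ.filter (fun x => c x = 1)).card = 8 + 2 * k := by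
    rw [← hcard, ← Finset.card_univ, ← Finset.card_union_of_disjoint]
    · congr 1
      ext x
      simp only [Finset.mem_union, Finset.mem_filter, Finset.mem_univ, true_and, iff_true]
      omega
    · rw [Finset.disjoint_left]
      intro x h h'
      simp at h h'
      omega
  set E : Set (Sym2 V) := {e : Sym2 V | e ∈ G.edgeSet ∧ ∃ v ∈ e, G.degree v = 1} with hE
  have hex : ∀ e : E, ∃ v u : V, (e : Sym2 V) = s(v, u) ∧ ∀ w, G.Adj v w ↔ w = u := by
    rintro ⟨e, he, v, hv, hd⟩
    obtain ⟨u, rfl⟩ := Sym2.mem_iff_exists.mp hv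
    refine ⟨v, u, rfl, fun w => ⟨fun h => ?_, fun h => ?_⟩⟩
    · exact (degree_eq_one_iff_existsUnique_adj.mp hd).unique h he
    · subst h; exact he
  choose v u hvu hadj using hex
  have hva : ∀ i, G.Adj (v i) (u i) := fun i => (hadj i _).mpr rfl
  have v_inj : Function.Injective v := by
    intro i j h
    have : u i = u j := by
      rw [← hadj j, ← h]; exact hva i
    apply Subtype.ext
    rw [hvu, hvu, h, this]
  have u_inj : Function.Injective u := by
    intro i j h
    by_contra hij
    refine fact2 A M hAM hMs hM (v i) (v j) (u i) (fun hh => hij (v_inj hh)) (hva i).ne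
      (by rw [h]; exact (hva j).ne) ?_ ?_
    · intro w hw
      rcases hAadj _ _ hw with h1 | h1
      · exact Or.inl h1
      · exact Or.inr (Or.inl ((hadj i w).mp h1))
    · intro w hw
      rcases hAadj _ _ hw with h1 | h1
      · exact Or.inl h1
      · exact Or.inr (Or.inl (((hadj j w).mp h1).trans h.symm))
  have hvu_ne : ∀ i j, v i ≠ u j := by
    intro i j h
    have h1 : G.Adj (v i) (v j) := by rw [h]; exact (hva j).symm
    have h2 : v j = u i := (hadj i _).mp h1
    have : i = j := by
      apply Subtype.ext
      rw [hvu, hvu, h, ← h2, Sym2.eq_swap]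
    subst this
    exact (hva i).ne h
  have hMu : ∀ i y, y ≠ v i → M (u i) y = 0 := by
    intro i y hy
    have hh : ∀ w, A (v i) w ≠ 0 → w = v i ∨ w = u i := by
      intro w hw
      rcases hAadj _ _ hw with h1 | h1
      · exact Or.inl h1
      · exact Or.inr ((hadj i w).mp h1)
    obtain ⟨a1, a2⟩ := fact2a A M hAM hMs hM (v i) (u i) (hva i).ne
      (fun w hw => by have := hh w hw; tauto)
    have e := row_expand A M hAM (v i) (u i) (hva i).ne y
      (fun w hw => by have := hh w hw; tauto)
    rw [a1] at e
    simp [hy.symm] at e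
    rcases e with e | e
    · rw [e] at a2; norm_num at a2
    · exact e
  set p : Fin 2 → E → V := fun s i => if c (v i) = s then v i else u i with hp
  have hpor : ∀ s i, p s i = v i ∨ p s i = u i := by
    intro s i; simp only [hp]; split_ifs <;> simp
  have hpv : ∀ i, ∃ s, p s i = v i := fun i => ⟨c (v i), by simp [hp]⟩
  have hpu : ∀ i, ∃ s, p s i = u i := fun i => ⟨c (u i), by
    simp only [hp]; rw [if_neg (hc _ _ (hva i))]⟩
  have hP : ∀ x, (∀ s i, x ≠ p s i) ↔ ∀ i, x ≠ v i ∧ x ≠ u i := by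
    intro x
    constructor
    · intro h i
      obtain ⟨s, hs⟩ := hpv i
      obtain ⟨s', hs'⟩ := hpu i
      exact ⟨hs ▸ h s i, hs' ▸ h s' i⟩
    · intro h s i
      rcases hpor s i with h1 | h1 <;> rw [h1]
      · exact (h i).1
      · exact (h i).2
  have hnb : ∀ x w, (∀ s i, x ≠ p s i) → G.Adj x w → (∀ s i, w ≠ p s i) ∨
      ∀ y, (∀ s i, y ≠ p s i) → M w y = 0 := by
    intro x w hx hxw
    by_cases hw : ∀ s i, w ≠ p s i
    · exact Or.inl hw
    · right
      intro y hy
      rw [hP] at hx hy hw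
      push Not at hw
      obtain ⟨i, hi⟩ := hw
      have hwu : w = u i := by
        by_contra hne
        have hwv : w = v i := by by_contra h; exact hne (hi h)
        rw [hwv] at hxw
        exact (hx i).2 ((hadj i x).mp hxw.symm)
      rw [hwu]
      exact hMu i y (hy i).1
  refine comb G c hc p ?_ ?_ ?_ hbal ?_ ?_ ?_
  · intro s i
    have := hc _ _ (hva i)
    simp only [hp]
    split_ifs with h
    · exact h
    · omega
  · intro s i j hij
    simp only [hp] at hij
    split_ifs at hij
    · exact v_inj hij
    · exact (hvu_ne _ _ hij).elim
    · exact (hvu_ne _ _ hij.symm).elim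
    · exact u_inj hij
  · intro i
    simp only [hp]
    have : c (v i) = 0 ∨ c (v i) = 1 := by omega
    rcases this with h | h
    · simpa [h] using hva i
    · simpa [h] using (hva i).symm
  · have : E.ncard = Fintype.card E := by
      rw [← Nat.card_coe_set_eq, Nat.card_eq_fintype_card]
    omega
  · intro x hx
    by_contra hno
    push Not at hno
    refine fact1 A M hAM hM x fun y hy => ?_
    rcases hAadj _ _ hy with h | h
    · exact Or.inl h
    · rcases hnb x y hx h with h1 | h1
      · exact (hno y h1 h).elim
      · exact Or.inr (h1 x hx)
  · intro x y z hxy hx hy hz h h'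
    have gen : ∀ q, (∀ s i, q ≠ p s i) → (∀ w, (∀ s i, w ≠ p s i) → G.Adj q w → w = z) →
        ∀ w, A q w ≠ 0 → w = q ∨ w = z ∨ (M w x = 0 ∧ M w y = 0 ∧ M w z = 0) := by
      intro q hq hqz w hw
      rcases hAadj _ _ hw with h1 | h1
      · exact Or.inl h1
      · rcases hnb q w hq h1 with h2 | h2
        · exact Or.inr (Or.inl (hqz w h2 h1))
        · exact Or.inr (Or.inr ⟨h2 x hx, h2 y hy, h2 z hz⟩)
    have ne : ∀ q, (∀ s i, q ≠ p s i) → (∀ w, (∀ s i, w ≠ p s i) → G.Adj q w → w = z) →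
        q ≠ z := by
      intro q hq hqz hqe
      refine fact1 A M hAM hM q fun w hw => ?_
      rcases hAadj _ _ hw with h1 | h1
      · exact Or.inl h1
      · rcases hnb q w hq h1 with h2 | h2
        · exact Or.inl ((hqz w h2 h1).trans hqe.symm)
        · exact Or.inr (h2 q hq)
    exact fact2 A M hAM hMs hM x y z hxy (ne x hx h) (ne y hy h') (gen x hx h) (gen y hy h')

theorem backward {V : Type*} [Fintype V] [DecidableEq V] (G : SimpleGraph V)
    (c : V → Fin 2) (hc : ∀ x y, G.Adj x y → c x ≠ c y) (m : ℕ)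
    (hcard : Fintype.card V = 2 * m)
    (S : G.Subgraph) (hS : S.IsPerfectMatching) :
    ∃ A : Matrix V V ℝ, A.IsSymm ∧
    (∀ u v : V, u ≠ v → (A u v ≠ 0 ↔ G.Adj u v)) ∧
    A.det ≠ 0 ∧
    ∀ v : V,
      (A.submatrix (fun x : {x : V // x ≠ v} => (x : V))
        (fun x : {x : V // x ≠ v} => (x : V))).det = 0 := by
  classical
  rw [Subgraph.isPerfectMatching_iff] at hS
  set Q : Matrix V V ℝ := fun x y => if S.Adj x y then 1 else 0 with hQ
  set R : Matrix V V ℝ := fun x y => if G.Adj x y then 1 else 0 with hR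
  have hQQ : Q * Q = 1 := by
    ext x y
    rw [Matrix.mul_apply]
    obtain ⟨w, hw, huw⟩ := hS x
    rw [Finset.sum_eq_single w]
    · simp only [hQ, if_pos hw, one_mul, Matrix.one_apply]
      congr 1
      rw [eq_iff_iff]
      constructor
      · intro h
        exact (hS w).unique hw.symm h
      · rintro rfl; exact hw.symm
    · intro z _ hz
      have : ¬ S.Adj x z := fun h => hz (huw z h)
      simp [hQ, this]
    · simp
  have hQdet : Q.det ≠ 0 := by
    intro h
    have := congrArg Matrix.det hQQ
    rw [Matrix.det_mul, h] at this
    simp at this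
  have hcont : Continuous (fun t : ℝ => (Q + t • R).det) := by fun_prop
  have hev : ∀ᶠ t in nhds (0 : ℝ), (Q + t • R).det ≠ 0 := by
    apply hcont.continuousAt.eventually_ne
    simpa using hQdet
  obtain ⟨t, ht, ht0⟩ := ((hev.filter_mono nhdsWithin_le_nhds).and
    (self_mem_nhdsWithin : Set.Ioi (0 : ℝ) ∈ nhdsWithin 0 (Set.Ioi 0))).exists
  have ht0 : 0 < t := ht0
  have hent : ∀ x y, (Q + t • R) x y =
      (if S.Adj x y then 1 else 0) + t * (if G.Adj x y then 1 else 0) := fun x y => rfl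
  have hval : ∀ x y, (Q + t • R) x y ≠ 0 ↔ G.Adj x y := by
    intro x y
    rw [hent]
    by_cases hG : G.Adj x y
    · simp only [hG, if_true, iff_true]
      split_ifs <;> positivity
    · have : ¬ S.Adj x y := fun h => hG h.adj_sub
      simp [hG, this]
  refine ⟨Q + t • R, ?_, fun u v _ => hval u v, ht, ?_⟩
  · ext x y
    rw [Matrix.transpose_apply, hent, hent]
    simp only [S.adj_comm y x, G.adj_comm y x]
  · intro v
    set N := (Q + t • R).submatrix (fun x : {x : V // x ≠ v} => (x : V))
        (fun x : {x : V // x ≠ v} => (x : V)) with hN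
    set D : Matrix {x : V // x ≠ v} {x : V // x ≠ v} ℝ :=
      Matrix.diagonal (fun x => if c x = 0 then 1 else -1) with hD
    have hDD : D * D = 1 := by
      rw [hD, Matrix.diagonal_mul_diagonal, ← Matrix.diagonal_one]
      congr 1
      ext x
      split_ifs <;> norm_num
    have hDN : D * N * D = -N := by
      ext x y
      rw [hD, Matrix.mul_diagonal, Matrix.diagonal_mul, Matrix.neg_apply]
      by_cases h0 : N x y = 0
      · simp [h0]
      · have := hc _ _ ((hval x y).mp h0)
        by_cases hx : c x = 0
        · have hy : c y ≠ 0 := by omega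
          simp [hx, hy]
        · have hy : c y = 0 := by omega
          simp [hx, hy]
    have hd := congrArg Matrix.det hDN
    have hd1 := congrArg Matrix.det hDD
    rw [Matrix.det_neg] at hd
    rw [Matrix.det_mul, Matrix.det_one] at hd1
    rw [Matrix.det_mul, Matrix.det_mul] at hd
    have hodd : Odd (Fintype.card {x : V // x ≠ v}) := by
      have h1 : Fintype.card {x : V // x ≠ v} = Fintype.card V - 1 := by
        simp
      have : 0 < Fintype.card V := Fintype.card_pos_iff.mpr ⟨v⟩
      rw [h1, hcard]
      exact ⟨m - 1, by omega⟩
    rw [hodd.neg_one_pow] at hd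
    have : D.det * N.det * D.det = N.det := by
      calc _ = (D.det * D.det) * N.det := by ring
        _ = _ := by rw [hd1, one_mul]
    linarith

/-- A connected bipartite graph on 8 + 2k vertices having at least k pendant edges
has property (P) iff it has a perfect matching.  A pendant edge is an edge incident
with a vertex of degree 1. -/
theorem stmt_3 {V : Type*} [Fintype V] (G : SimpleGraph V) [DecidableRel G.Adj]
    (k : ℕ) (hconn : G.Connected) (hbip : G.Colorable 2)
    (hcard : Fintype.card V = 8 + 2 * k)
    (hpend : k ≤ {e : Sym2 V | e ∈ G.edgeSet ∧ ∃ v ∈ e, G.degree v = 1}.ncard) :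
    HasPropertyP G ↔ ∃ M : G.Subgraph, M.IsPerfectMatching := by
  classical
  obtain ⟨C⟩ := hbip
  have hc : ∀ x y, G.Adj x y → C x ≠ C y := fun x y h => C.valid h
  rw [hasP_iff]
  constructor
  · rintro ⟨A, hs, hA, hdet, hdel⟩
    have hu : IsUnit A.det := isUnit_iff_ne_zero.mpr hdet
    have hsi : (A⁻¹)ᵀ = A⁻¹ := by rw [Matrix.transpose_nonsing_inv, hs.eq]
    exact forward G k C hc hcard hpend A A⁻¹ (Matrix.mul_nonsing_inv _ hu)
      (fun x y => hs.apply y x) (fun x y => congrFun (congrFun hsi y) x)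
      (fun v => inv_diag_zero A hdet v (hdel v)) hA
  · rintro ⟨S, hS⟩
    exact backward G C hc (4 + k) (by omega) S hS
end

section
/- Let G be a connected finite simple graph that is a triangular bipartite graph: there exist an n ≥ 1 and enumerations a_1, …, a_n and b_1, …, b_n of two disjoint sets whose union is the vertex set of G, such that every edge of G joins some a_i to some b_j, and whenever a_i is adjacent to b_j one has i ≤ j. Then G has property (P) if and only if G has a perfect matching. -/
open Matrix SimpleGraph

theorem aux_det_delete {V : Type*} [Fintype V] [DecidableEq V] (A : Matrix V V ℝ) (v : V) :
    (A.submatrix (fun x : {x : V // x ≠ v} => (x : V))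
        (fun x : {x : V // x ≠ v} => (x : V))).det = A.adjugate v v := by
  rw [Matrix.adjugate_apply]
  rw [Matrix.twoBlockTriangular_det (A.updateRow v (Pi.single v 1)) (fun x => x ≠ v)]
  · have h2 : (toSquareBlockProp (A.updateRow v (Pi.single v 1)) fun i => ¬ (i ≠ v)).det = 1 := by
      have : (toSquareBlockProp (A.updateRow v (Pi.single v 1)) fun i => ¬ (i ≠ v)) = 1 := by
        ext ⟨i, hi⟩ ⟨j, hj⟩
        have hi' : i = v := not_not.mp hi
        have hj' : j = v := not_not.mp hj
        subst hi'
        subst hj'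
        simp [toSquareBlockProp]
      rw [this, Matrix.det_one]
    rw [h2, mul_one]
    congr 1
    ext ⟨i, hi⟩ ⟨j, hj⟩
    simp [toSquareBlockProp, Matrix.updateRow_apply, hi]
  · intro i hi j hj
    have hi' : i = v := not_not.mp hi
    subst hi'
    simp [hj]

theorem aux_sum {V : Type*} [Fintype V] (n : ℕ) (a b : Fin n → V)
    (ha : Function.Injective a) (hb : Function.Injective b)
    (hab : ∀ i j : Fin n, a i ≠ b j)
    (hcover : ∀ v : V, (∃ i, v = a i) ∨ (∃ j, v = b j)) (f : V → ℝ) :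
    ∑ v, f v = ∑ i, f (a i) + ∑ j, f (b j) := by
  have hbij : Function.Bijective (Sum.elim a b) := by
    refine ⟨ha.sumElim hb hab, fun v => ?_⟩
    rcases hcover v with ⟨i, rfl⟩ | ⟨j, rfl⟩
    · exact ⟨Sum.inl i, rfl⟩
    · exact ⟨Sum.inr j, rfl⟩
  rw [← Fintype.sum_bijective _ hbij (fun x => f (Sum.elim a b x)) f (fun _ => rfl),
    Fintype.sum_sum_type]
  rfl

theorem aux_down {n : ℕ} {P : Fin n → Prop} (h : ∀ k, (∀ j, k < j → P j) → P k) (k : Fin n) :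
    P k := by
  induction k using WellFoundedGT.induction with
  | ind k ih => exact h k ih

theorem aux_up {n : ℕ} {P : Fin n → Prop} (h : ∀ k, (∀ j, j < k → P j) → P k) (k : Fin n) :
    P k := by
  induction k using WellFoundedLT.induction with
  | ind k ih => exact h k ih

theorem aux_forward {V : Type*} [Fintype V] [DecidableEq V] (G : SimpleGraph V)
    (n : ℕ) (a b : Fin n → V)
    (ha : Function.Injective a) (hb : Function.Injective b)
    (hab : ∀ i j : Fin n, a i ≠ b j)
    (hcover : ∀ v : V, (∃ i, v = a i) ∨ (∃ j, v = b j))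
    (hedge : ∀ u v : V, G.Adj u v →
      ∃ i j : Fin n, (u = a i ∧ v = b j) ∨ (u = b j ∧ v = a i))
    (htri : ∀ i j : Fin n, G.Adj (a i) (b j) → i ≤ j)
    (A : Matrix V V ℝ) (hs : A.IsSymm)
    (hA : ∀ u v : V, u ≠ v → (A u v ≠ 0 ↔ G.Adj u v))
    (hdet : A.det ≠ 0)
    (hdel : ∀ v : V, (A.submatrix (fun x : {x : V // x ≠ v} => (x : V))
        (fun x : {x : V // x ≠ v} => (x : V))).det = 0) (k : Fin n) :
    G.Adj (a k) (b k) := by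
  have hAC : A * A⁻¹ = 1 := Matrix.mul_nonsing_inv A (isUnit_iff_ne_zero.mpr hdet)
  have hCd : ∀ v, A⁻¹ v v = 0 := by
    intro v
    have := hdel v
    rw [aux_det_delete] at this
    rw [Matrix.inv_def]
    simp [this]
  have hCs : ∀ u v, A⁻¹ u v = A⁻¹ v u := by
    intro u v
    have h : (A⁻¹)ᵀ = A⁻¹ := by rw [Matrix.transpose_nonsing_inv, hs.eq]
    conv_lhs => rw [← h]
    rfl
  generalize A⁻¹ = C at hAC hCd hCs
  have haa : ∀ i j, i ≠ j → A (a i) (a j) = 0 := by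
    intro i j hij
    by_contra h
    obtain ⟨p, q, ⟨h1, h2⟩ | ⟨h1, h2⟩⟩ := hedge _ _ ((hA _ _ (fun h => hij (ha h))).1 h)
    · exact hab _ _ h2
    · exact hab _ _ h1
  have hBz : ∀ i j, j < i → A (a i) (b j) = 0 := by
    intro i j hij
    by_contra h
    exact absurd (htri i j ((hA _ _ (hab _ _)).1 h)) (not_le.mpr hij)
  have hrow : ∀ k x, A (a k) (a k) * C (a k) x + ∑ j, A (a k) (b j) * C (b j) x
      = (1 : Matrix V V ℝ) (a k) x := by
    intro k x
    rw [← hAC, Matrix.mul_apply, aux_sum n a b ha hb hab hcover]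
    congr 1
    symm
    apply Finset.sum_eq_single
    · intro i _ hi
      rw [haa k i hi.symm, zero_mul]
    · simp
  have hrow' : ∀ k x, (∀ j, k < j → C (b j) x = 0) →
      A (a k) (a k) * C (a k) x + A (a k) (b k) * C (b k) x = (1 : Matrix V V ℝ) (a k) x := by
    intro k x h
    rw [← hrow k x]
    congr 1
    symm
    apply Finset.sum_eq_single
    · intro j _ hj
      rcases lt_or_gt_of_ne hj with h1 | h1
      · rw [hBz k j h1, zero_mul]
      · rw [h j h1, mul_zero]
    · simp
  have key : ∀ k : Fin n, A (a k) (b k) ≠ 0 ∧ (∀ i, i < k → C (b k) (a i) = 0) ∧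
      (∀ i, i ≤ k → C (b k) (b i) = 0) := by
    apply aux_down
    intro k ih
    have e1 := hrow' k (a k) (fun j hj => (ih j hj).2.1 k hj)
    have e2 := hrow' k (b k) (fun j hj => (ih j hj).2.2 k hj.le)
    rw [hCd, mul_zero, zero_add, Matrix.one_apply_eq] at e1
    rw [hCd, mul_zero, add_zero, Matrix.one_apply_ne (hab _ _)] at e2
    have hB : A (a k) (b k) ≠ 0 := fun h => by simp [h] at e1
    have hC : C (b k) (a k) ≠ 0 := fun h => by simp [h] at e1
    have hd : A (a k) (a k) = 0 := by
      rcases mul_eq_zero.1 e2 with h | h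
      · exact h
      · rw [hCs] at h
        exact absurd h hC
    refine ⟨hB, fun i hi => ?_, fun i hi => ?_⟩
    · have e := hrow' k (a i) (fun j hj => (ih j hj).2.1 i (hi.trans hj))
      rw [hd, zero_mul, zero_add, Matrix.one_apply_ne (fun h => hi.ne' (ha h))] at e
      exact (mul_eq_zero.1 e).resolve_left hB
    · have e := hrow' k (b i) (fun j hj => (ih j hj).2.2 i (hi.trans hj.le))
      rw [hd, zero_mul, zero_add, Matrix.one_apply_ne (hab _ _)] at e
      exact (mul_eq_zero.1 e).resolve_left hB
  exact (hA _ _ (hab _ _)).1 (key k).1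

theorem aux_backward {V : Type*} [Fintype V] [DecidableEq V] (G : SimpleGraph V)
    (n : ℕ) (a b : Fin n → V)
    (ha : Function.Injective a) (hb : Function.Injective b)
    (hab : ∀ i j : Fin n, a i ≠ b j)
    (hcover : ∀ v : V, (∃ i, v = a i) ∨ (∃ j, v = b j))
    (hedge : ∀ u v : V, G.Adj u v →
      ∃ i j : Fin n, (u = a i ∧ v = b j) ∨ (u = b j ∧ v = a i))
    (htri : ∀ i j : Fin n, G.Adj (a i) (b j) → i ≤ j)
    (hadj : ∀ k, G.Adj (a k) (b k)) :
    ∃ A : Matrix V V ℝ, A.IsSymm ∧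
    (∀ u v : V, u ≠ v → (A u v ≠ 0 ↔ G.Adj u v)) ∧
    A.det ≠ 0 ∧
    ∀ v : V,
      (A.submatrix (fun x : {x : V // x ≠ v} => (x : V))
        (fun x : {x : V // x ≠ v} => (x : V))).det = 0 := by
  classical
  obtain ⟨A, hAdef⟩ : ∃ A : Matrix V V ℝ, A = G.adjMatrix ℝ := ⟨_, rfl⟩
  have hA : ∀ u v, A u v = if G.Adj u v then 1 else 0 := by
    intro u v
    rw [hAdef, SimpleGraph.adjMatrix_apply]
  have haa : ∀ i j, A (a i) (a j) = 0 := by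
    intro i j
    rw [hA, if_neg]
    intro h
    obtain ⟨p, q, ⟨h1, h2⟩ | ⟨h1, h2⟩⟩ := hedge _ _ h
    · exact hab _ _ h2
    · exact hab _ _ h1
  have hbb : ∀ i j, A (b i) (b j) = 0 := by
    intro i j
    rw [hA, if_neg]
    intro h
    obtain ⟨p, q, ⟨h1, h2⟩ | ⟨h1, h2⟩⟩ := hedge _ _ h
    · exact hab _ _ h1.symm
    · exact hab _ _ h2.symm
  have hsym : ∀ u v, A u v = A v u := by
    intro u v
    rw [hA, hA, SimpleGraph.adj_comm]
  have hBz : ∀ i j, j < i → A (a i) (b j) = 0 := by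
    intro i j hij
    rw [hA, if_neg]
    intro h
    exact absurd (htri i j h) (not_le.mpr hij)
  have hB1 : ∀ k, A (a k) (b k) = 1 := fun k => by rw [hA, if_pos (hadj k)]
  have hdet : A.det ≠ 0 := by
    intro h0
    obtain ⟨x, hx, hx0⟩ := Matrix.exists_mulVec_eq_zero_iff.mpr h0
    apply hx
    have hr : ∀ u, ∑ i, A u (a i) * x (a i) + ∑ j, A u (b j) * x (b j) = 0 := by
      intro u
      rw [← aux_sum n a b ha hb hab hcover (fun v => A u v * x v)]
      exact congrFun hx0 u
    have hxb : ∀ k, x (b k) = 0 := by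
      apply aux_down
      intro k ih
      have e := hr (a k)
      rw [Finset.sum_eq_zero (fun i _ => by rw [haa, zero_mul]), zero_add,
        Finset.sum_eq_single k, hB1, one_mul] at e
      · exact e
      · intro j _ hj
        rcases lt_or_gt_of_ne hj with h1 | h1
        · rw [hBz k j h1, zero_mul]
        · rw [ih j h1, mul_zero]
      · simp
    have hxa : ∀ k, x (a k) = 0 := by
      apply aux_up
      intro k ih
      have e := hr (b k)
      rw [Finset.sum_eq_zero (s := Finset.univ) (f := fun j => A (b k) (b j) * x (b j))
        (fun i _ => by rw [hbb, zero_mul]), add_zero,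
        Finset.sum_eq_single k, hsym, hB1, one_mul] at e
      · exact e
      · intro j _ hj
        rcases lt_or_gt_of_ne hj with h1 | h1
        · rw [ih j h1, mul_zero]
        · rw [hsym, hBz j k h1, zero_mul]
      · simp
    funext v
    rcases hcover v with ⟨i, rfl⟩ | ⟨j, rfl⟩
    · exact hxa i
    · exact hxb j
  refine ⟨A, ?_, ?_, hdet, ?_⟩
  · ext u v
    exact hsym v u
  · intro u v _
    rw [hA]
    simp
  · intro v
    rw [aux_det_delete]
    have hu : IsUnit A.det := isUnit_iff_ne_zero.mpr hdet
    obtain ⟨s, hs⟩ : ∃ s : V → ℝ, s = fun v => if ∃ i, v = a i then 1 else -1 := ⟨_, rfl⟩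
    have hsa : ∀ i, s (a i) = 1 := fun i => by rw [hs]; exact if_pos ⟨i, rfl⟩
    have hsb : ∀ j, s (b j) = -1 := fun j => by
      rw [hs]
      exact if_neg (fun ⟨i, hi⟩ => hab i j hi.symm)
    have hss : ∀ v, s v * s v = 1 := by
      intro v
      rcases hcover v with ⟨i, rfl⟩ | ⟨j, rfl⟩
      · rw [hsa]; norm_num
      · rw [hsb]; norm_num
    have hSS : Matrix.diagonal s * Matrix.diagonal s = 1 := by
      rw [Matrix.diagonal_mul_diagonal]
      simp [hss]
    have hSA : Matrix.diagonal s * A = -(A * Matrix.diagonal s) := by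
      ext u w
      rw [Matrix.neg_apply, Matrix.diagonal_mul, Matrix.mul_diagonal]
      rcases hcover u with ⟨i, rfl⟩ | ⟨i, rfl⟩ <;> rcases hcover w with ⟨j, rfl⟩ | ⟨j, rfl⟩ <;>
        simp [hsa, hsb, haa, hbb]
    have hinv : A⁻¹ = -(Matrix.diagonal s * A⁻¹ * Matrix.diagonal s) := by
      apply Matrix.inv_eq_right_inv
      have : A * Matrix.diagonal s = -(Matrix.diagonal s * A) := by rw [hSA, neg_neg]
      rw [mul_neg, ← mul_assoc, ← mul_assoc, this, neg_mul, neg_mul, neg_neg,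
        mul_assoc (Matrix.diagonal s) A, Matrix.mul_nonsing_inv A hu, mul_one, hSS]
    have hv := congrFun (congrFun hinv v) v
    rw [Matrix.neg_apply, Matrix.mul_diagonal, Matrix.diagonal_mul,
      mul_right_comm, hss, one_mul] at hv
    have hz : A⁻¹ v v = 0 := by linarith
    rw [Matrix.inv_def, Matrix.smul_apply, smul_eq_mul, Ring.inverse_eq_inv'] at hz
    exact (mul_eq_zero.1 hz).resolve_left (inv_ne_zero hdet)

theorem aux_matching {V : Type*} (G : SimpleGraph V)
    (n : ℕ) (a b : Fin n → V)
    (ha : Function.Injective a) (hb : Function.Injective b)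
    (hab : ∀ i j : Fin n, a i ≠ b j)
    (hcover : ∀ v : V, (∃ i, v = a i) ∨ (∃ j, v = b j))
    (hedge : ∀ u v : V, G.Adj u v →
      ∃ i j : Fin n, (u = a i ∧ v = b j) ∨ (u = b j ∧ v = a i))
    (htri : ∀ i j : Fin n, G.Adj (a i) (b j) → i ≤ j) :
    (∃ M : G.Subgraph, M.IsPerfectMatching) ↔ ∀ k, G.Adj (a k) (b k) := by
  constructor
  · rintro ⟨M, hM⟩
    rw [SimpleGraph.Subgraph.isPerfectMatching_iff] at hM
    have hex : ∀ i, ∃ j, M.Adj (a i) (b j) := by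
      intro i
      obtain ⟨w, hw, -⟩ := hM (a i)
      obtain ⟨p, q, ⟨h1, h2⟩ | ⟨h1, h2⟩⟩ := hedge _ _ hw.adj_sub
      · exact ⟨q, h2 ▸ hw⟩
      · exact absurd h1 (hab _ _)
    choose σ hσ using hex
    have hinj : Function.Injective σ := by
      intro i j hij
      apply ha
      have h1 := (hσ i).symm
      have h2 := (hσ j).symm
      rw [← hij] at h2
      exact (hM (b (σ i))).unique h1 h2
    have hid : ∀ k, σ k = k := by
      apply aux_down
      intro k ih
      rcases (htri _ _ (hσ k).adj_sub).eq_or_lt with h | h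
      · exact h.symm
      · exact hinj (ih _ h)
    intro k
    have := (hσ k).adj_sub
    rwa [hid] at this
  · intro h
    refine ⟨{ verts := Set.univ
              Adj := fun u v => ∃ i, (u = a i ∧ v = b i) ∨ (u = b i ∧ v = a i)
              adj_sub := ?_
              edge_vert := fun _ => Set.mem_univ _
              symm := ?_ }, ?_⟩
    · rintro u v ⟨i, ⟨rfl, rfl⟩ | ⟨rfl, rfl⟩⟩
      · exact h i
      · exact (h i).symm
    · refine ⟨?_⟩
      rintro u v ⟨i, h | h⟩
      · exact ⟨i, Or.inr ⟨h.2, h.1⟩⟩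
      · exact ⟨i, Or.inl ⟨h.2, h.1⟩⟩
    · rw [SimpleGraph.Subgraph.isPerfectMatching_iff]
      intro v
      rcases hcover v with ⟨i, rfl⟩ | ⟨i, rfl⟩
      · refine ⟨b i, ⟨i, Or.inl ⟨rfl, rfl⟩⟩, ?_⟩
        rintro w ⟨j, ⟨h1, rfl⟩ | ⟨h1, -⟩⟩
        · rw [ha h1]
        · exact absurd h1 (hab _ _)
      · refine ⟨a i, ⟨i, Or.inr ⟨rfl, rfl⟩⟩, ?_⟩
        rintro w ⟨j, ⟨h1, -⟩ | ⟨h1, rfl⟩⟩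
        · exact absurd h1.symm (hab _ _)
        · rw [hb h1]

/-- A connected triangular bipartite graph (there are enumerations a_1,…,a_n and
b_1,…,b_n of the two partite sets such that adjacency of a_i and b_j forces i ≤ j)
has property (P) iff it has a perfect matching. -/
theorem stmt_4 {V : Type*} [Fintype V] (G : SimpleGraph V) (hconn : G.Connected)
    (n : ℕ) (hn : 1 ≤ n) (a b : Fin n → V)
    (ha : Function.Injective a) (hb : Function.Injective b)
    (hab : ∀ i j : Fin n, a i ≠ b j)
    (hcover : ∀ v : V, (∃ i, v = a i) ∨ (∃ j, v = b j))
    (hedge : ∀ u v : V, G.Adj u v →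
      ∃ i j : Fin n, (u = a i ∧ v = b j) ∨ (u = b j ∧ v = a i))
    (htri : ∀ i j : Fin n, G.Adj (a i) (b j) → i ≤ j) :
    HasPropertyP G ↔ ∃ M : G.Subgraph, M.IsPerfectMatching := by
  rw [aux_matching G n a b ha hb hab hcover hedge htri]
  constructor
  · intro h
    letI : Fintype V := Fintype.ofFinite V
    letI : DecidableEq V := Classical.decEq V
    obtain ⟨A, hs, hA, hdet, hdel⟩ := h
    refine aux_forward G n a b ha hb hab hcover hedge htri A hs hA hdet fun v => ?_
    convert hdel v
  · intro h
    letI : Fintype V := Fintype.ofFinite V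
    letI : DecidableEq V := Classical.decEq V
    obtain ⟨A, hs, hA, hdet, hdel⟩ := aux_backward G n a b ha hb hab hcover hedge htri h
    refine ⟨A, hs, hA, hdet, fun v => ?_⟩
    convert hdel v
end

section
/- Let n ≥ 3 and let k be a natural number with 1 ≤ k and 2k ≤ n − 1. Then the generalized Petersen graph P(n,k) is bipartite (2-colorable) if and only if n is even and k is odd. -/
open SimpleGraph

/-- The generalized Petersen graph `P(n,k)` on the vertex set `ZMod n ⊕ ZMod n`:
outer cycle edges `inl i ~ inl (i+1)`, inner edges `inr i ~ inr (i+k)`, and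
spokes `inl i ~ inr i`. -/
def genPetersen (n k : ℕ) : SimpleGraph (ZMod n ⊕ ZMod n) :=
  SimpleGraph.fromRel fun x y =>
    (∃ i : ZMod n, x = Sum.inl i ∧ y = Sum.inl (i + 1)) ∨
    (∃ i : ZMod n, x = Sum.inr i ∧ y = Sum.inr (i + (k : ZMod n))) ∨
    (∃ i : ZMod n, x = Sum.inl i ∧ y = Sum.inr i)

/-- For `n ≥ 3`, `1 ≤ k`, `2k ≤ n - 1`, the generalized Petersen graph `P(n,k)` is
bipartite iff `n` is even and `k` is odd. -/
theorem stmt_6 (n k : ℕ) (hn : 3 ≤ n) (hk : 1 ≤ k) (hkn : 2 * k ≤ n - 1) :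
    (genPetersen n k).Colorable 2 ↔ Even n ∧ Odd k := by
  haveI : NeZero n := ⟨by omega⟩
  have h1n : (1 : ZMod n) ≠ 0 := by
    intro h
    have h' : ((1 : ℕ) : ZMod n) = 0 := by exact_mod_cast h
    rw [ZMod.natCast_eq_zero_iff] at h'
    have := Nat.le_of_dvd (by norm_num) h'
    omega
  have hkn0 : (k : ZMod n) ≠ 0 := by
    intro h
    rw [ZMod.natCast_eq_zero_iff] at h
    have := Nat.le_of_dvd (by omega) h
    omega
  constructor
  · rintro ⟨C⟩
    have hout : ∀ i : ZMod n, C (Sum.inl i) ≠ C (Sum.inl (i + 1)) := fun i => by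
      apply C.valid
      rw [genPetersen, SimpleGraph.fromRel_adj]
      exact ⟨by simpa using h1n, Or.inl (Or.inl ⟨i, rfl, rfl⟩)⟩
    have hin : ∀ i : ZMod n, C (Sum.inr i) ≠ C (Sum.inr (i + k)) := fun i => by
      apply C.valid
      rw [genPetersen, SimpleGraph.fromRel_adj]
      exact ⟨by simpa using hkn0, Or.inl (Or.inr (Or.inl ⟨i, rfl, rfl⟩))⟩
    have hsp : ∀ i : ZMod n, C (Sum.inl i) ≠ C (Sum.inr i) := fun i => by
      apply C.valid
      rw [genPetersen, SimpleGraph.fromRel_adj]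
      exact ⟨by simp, Or.inl (Or.inr (Or.inr ⟨i, rfl, rfl⟩))⟩
    have key : ∀ m : ℕ, C (Sum.inl (m : ZMod n)) = C (Sum.inl 0) ↔ Even m := by
      intro m
      induction m with
      | zero => simp
      | succ m ih =>
        have h := hout m
        rw [Nat.even_add_one, ← ih]
        push_cast
        constructor
        · intro h1 h2
          exact h (h2.trans h1.symm)
        · intro h1
          generalize C (Sum.inl (m : ZMod n)) = a at *
          generalize C (Sum.inl ((m : ZMod n) + 1)) = b at *
          generalize C (Sum.inl (0 : ZMod n)) = c at *
          omega
    refine ⟨(key n).1 (by simp), ?_⟩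
    rw [← Nat.not_even_iff_odd, ← key k]
    have a := hin 0
    have b := hsp 0
    have c := hsp k
    rw [zero_add] at a
    intro h
    omega
  · rintro ⟨hne, hko⟩
    let φ : ZMod n →+* ZMod 2 := ZMod.castHom hne.two_dvd (ZMod 2)
    have hφk : φ k = 1 := by
      rw [map_natCast]
      exact (ZMod.natCast_eq_one_iff_odd).2 hko
    have h01 : ∀ x : ZMod 2, x ≠ x + 1 := by decide
    let c : ZMod n ⊕ ZMod n → ZMod 2 := Sum.elim (fun i => φ i) (fun i => φ i + 1)
    have hc : ∀ x y, (genPetersen n k).Adj x y → c x ≠ c y := by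
      intro x y h
      rw [genPetersen, SimpleGraph.fromRel_adj] at h
      rcases h with ⟨-, (⟨i, rfl, rfl⟩ | ⟨i, rfl, rfl⟩ | ⟨i, rfl, rfl⟩) |
        (⟨i, rfl, rfl⟩ | ⟨i, rfl, rfl⟩ | ⟨i, rfl, rfl⟩)⟩
      · simpa [c] using h01 (φ i)
      · simp only [c, Sum.elim_inr, map_add, hφk]; exact h01 _
      · exact h01 (φ i)
      · simpa [c] using (h01 (φ i)).symm
      · simp only [c, Sum.elim_inr, map_add, hφk]; exact (h01 _).symm
      · exact (h01 (φ i)).symm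
    exact ⟨SimpleGraph.Coloring.mk (α := Fin 2) c (fun {x y} h => hc x y h)⟩
end

section
/- For every natural number n > 1, the complete graph K_n on n vertices has property (P). Explicitly, the real symmetric matrix A of order n with every diagonal entry equal to 2 − n and every off-diagonal entry equal to 1 satisfies det A ≠ 0 and det A(i) = 0 for every index i. -/
open Matrix SimpleGraph

theorem aux_mulVec {V : Type*} [Fintype V] [DecidableEq V] (c : ℝ) (x : V → ℝ) (i : V) :
    ((Matrix.of fun i j : V => if i = j then c else (1 : ℝ)) *ᵥ x) i
      = (∑ j, x j) + (c - 1) * x i := by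
  have h : ∀ j, (if i = j then c else (1 : ℝ)) * x j
      = x j + (if i = j then (c - 1) * x j else 0) := by
    intro j
    split_ifs <;> ring
  simp only [Matrix.mulVec, dotProduct, Matrix.of_apply, h, Finset.sum_add_distrib]
  simp

theorem aux_det (n : ℕ) (hn : 1 < n) :
    (Matrix.of fun i j : Fin n => if i = j then (2 - (n : ℝ)) else 1).det ≠ 0 := by
  intro h
  obtain ⟨x, hx, hA⟩ := Matrix.exists_mulVec_eq_zero_iff.mpr h
  have hi : ∀ i, (∑ j, x j) + (2 - (n : ℝ) - 1) * x i = 0 := fun i => by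
    rw [← aux_mulVec, hA]; rfl
  have hs : ∑ i : Fin n, ((∑ j, x j) + (2 - (n : ℝ) - 1) * x i) = 0 :=
    Finset.sum_eq_zero fun i _ => hi i
  rw [Finset.sum_add_distrib, ← Finset.mul_sum] at hs
  simp only [Finset.sum_const, Finset.card_univ, Fintype.card_fin, nsmul_eq_mul] at hs
  have h0 : ∑ j, x j = 0 := by linarith
  have hn' : (1 : ℝ) < n := by exact_mod_cast hn
  apply hx
  funext i
  have := hi i
  rw [h0, zero_add] at this
  rcases mul_eq_zero.mp this with h1 | h1
  · linarith
  · exact h1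

theorem aux_sub (n : ℕ) (hn : 1 < n) (i : Fin n) :
      ((Matrix.of fun i j : Fin n => if i = j then (2 - (n : ℝ)) else 1).submatrix
        (fun x : {x : Fin n // x ≠ i} => (x : Fin n))
        (fun x : {x : Fin n // x ≠ i} => (x : Fin n))).det = 0 := by
  have he : ((Matrix.of fun i j : Fin n => if i = j then (2 - (n : ℝ)) else 1).submatrix
        (fun x : {x : Fin n // x ≠ i} => (x : Fin n))
        (fun x : {x : Fin n // x ≠ i} => (x : Fin n)))
      = Matrix.of fun a b : {x : Fin n // x ≠ i} => if a = b then (2 - (n : ℝ)) else 1 := by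
    ext a b
    simp [Subtype.ext_iff]
  rw [he]
  apply Matrix.exists_mulVec_eq_zero_iff.mp
  refine ⟨fun _ => 1, ?_, ?_⟩
  · haveI : Nontrivial (Fin n) := Fin.nontrivial_iff_two_le.mpr hn
    obtain ⟨j, hj⟩ := exists_ne i
    intro h
    have := congrFun h ⟨j, hj⟩
    simp at this
  · funext a
    rw [aux_mulVec]
    have hc : Fintype.card {x : Fin n // x ≠ i} = n - 1 := by
      simp [Fintype.card_subtype_compl]
    simp only [Finset.sum_const, Finset.card_univ, hc, nsmul_eq_mul, Pi.zero_apply]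
    rw [Nat.cast_sub hn.le]
    push_cast
    ring

/-- For every `n > 1`, the complete graph on `n` vertices has property (P); explicitly,
the matrix with diagonal entries `2 - n` and off-diagonal entries `1` is nonsingular and
all of its principal submatrices of order `n - 1` are singular. -/
theorem stmt_11 (n : ℕ) (hn : 1 < n) :
    HasPropertyP (completeGraph (Fin n)) ∧
    (Matrix.of fun i j : Fin n => if i = j then (2 - (n : ℝ)) else 1).det ≠ 0 ∧
    ∀ i : Fin n,
      ((Matrix.of fun i j : Fin n => if i = j then (2 - (n : ℝ)) else 1).submatrix
        (fun x : {x : Fin n // x ≠ i} => (x : Fin n))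
        (fun x : {x : Fin n // x ≠ i} => (x : Fin n))).det = 0 := by
  refine ⟨?_, aux_det n hn, aux_sub n hn⟩
  refine ⟨Matrix.of fun i j : Fin n => if i = j then (2 - (n : ℝ)) else 1, ?_, ?_, ?_, ?_⟩
  · ext a b
    simp [eq_comm]
  · intro u v huv
    simp [huv]
  · convert aux_det n hn
  · intro v
    convert aux_sub n hn v
end

section
/- Let m, n ≥ 1 and let L(m,n) be the lollipop graph. If either (m > 1 and n is even) or (m > 2), then L(m,n) has property (P). -/
open Matrix SimpleGraph

/-- The lollipop graph `L(m,n)` on `Fin m ⊕ Fin n`: a complete graph on the `inl`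
vertices, a path on the `inr` vertices (consecutive values adjacent), and a bridge
joining `inl 0` to `inr 0`. -/
def lollipop (m n : ℕ) : SimpleGraph (Fin m ⊕ Fin n) :=
  SimpleGraph.fromRel fun x y =>
    (∃ a b : Fin m, a ≠ b ∧ x = Sum.inl a ∧ y = Sum.inl b) ∨
    (∃ a b : Fin n, (b : ℕ) = (a : ℕ) + 1 ∧ x = Sum.inr a ∧ y = Sum.inr b) ∨
    (∃ (hm : 0 < m) (hn : 0 < n), x = Sum.inl ⟨0, hm⟩ ∧ y = Sum.inr ⟨0, hn⟩)

/-- Explicit-inverse version of property (P). -/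
def QProp {V : Type} [Fintype V] [DecidableEq V] (G : SimpleGraph V) : Prop :=
  ∃ A B : Matrix V V ℝ, A.IsSymm ∧ (∀ u v : V, u ≠ v → (A u v ≠ 0 ↔ G.Adj u v)) ∧
    A * B = 1 ∧ ∀ v, B v v = 0

lemma det_del_zero {V : Type} [Fintype V] [DecidableEq V] (A B : Matrix V V ℝ)
    (hAB : A * B = 1) (v : V) (hv : B v v = 0) :
    (A.submatrix (fun x : {x : V // x ≠ v} => (x : V))
        (fun x : {x : V // x ≠ v} => (x : V))).det = 0 := by
  have key : ∀ i, ∑ k : {x : V // x ≠ v}, A i k * B k v = if i = v then 1 else 0 := by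
    intro i
    have h1 : (A * B) i v = if i = v then 1 else 0 := by rw [hAB, Matrix.one_apply]
    rw [Matrix.mul_apply] at h1
    rw [← h1]
    rw [← Finset.add_sum_erase _ _ (Finset.mem_univ v), hv, mul_zero, zero_add]
    exact (Finset.sum_subtype (p := fun x => x ≠ v) _ (by simp) (fun k => A i k * B k v)).symm
  apply Matrix.exists_mulVec_eq_zero_iff.mp
  refine ⟨fun k => B k v, ?_, ?_⟩
  · intro h0
    have h2 := key v
    have h3 : ∀ k : {x : V // x ≠ v}, B k v = 0 := fun k => congrFun h0 k
    simp [h3] at h2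
  · funext i
    have h2 := key i
    rw [if_neg i.2] at h2
    simpa [Matrix.mulVec, dotProduct] using h2

lemma QProp.hasPropertyP {V : Type} [i1 : Fintype V] [i2 : DecidableEq V] {G : SimpleGraph V}
    (h : QProp G) : HasPropertyP G := by
  have h' : @QProp V (Fintype.ofFinite V) (Classical.decEq V) G := by
    convert h
  clear h
  letI : Fintype V := Fintype.ofFinite V
  letI : DecidableEq V := Classical.decEq V
  obtain ⟨A, B, hs, hp, hAB, hB⟩ := h'
  refine ⟨A, hs, hp, ?_, fun v => ?_⟩
  · intro h0
    have := congrArg Matrix.det hAB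
    rw [Matrix.det_mul, h0, zero_mul, Matrix.det_one] at this
    exact zero_ne_one this
  · exact det_del_zero A B hAB v (hB v)

lemma QProp.join {V W U : Type} [Fintype V] [DecidableEq V] [Fintype W] [DecidableEq W]
    [Fintype U] [DecidableEq U] {G : SimpleGraph V} {H : SimpleGraph W} {K : SimpleGraph U}
    (hG : QProp G) (hH : QProp H) (S : V → Prop) (q : W) (e : V ⊕ W ≃ U)
    (h1 : ∀ a b, K.Adj (e (.inl a)) (e (.inl b)) ↔ G.Adj a b)
    (h2 : ∀ a b, K.Adj (e (.inr a)) (e (.inr b)) ↔ H.Adj a b)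
    (h3 : ∀ a b, K.Adj (e (.inl a)) (e (.inr b)) ↔ S a ∧ b = q) : QProp K := by
  classical
  obtain ⟨A1, B1, s1, p1, m1, d1⟩ := hG
  obtain ⟨A2, B2, s2, p2, m2, d2⟩ := hH
  have m1' := mul_eq_one_comm.mp m1
  have sB1 : B1ᵀ = B1 := by
    have : B1ᵀ * A1 = 1 := by
      have := congrArg Matrix.transpose m1
      rwa [Matrix.transpose_mul, s1.eq, Matrix.transpose_one] at this
    calc B1ᵀ = B1ᵀ * (A1 * B1) := by rw [m1, mul_one]
      _ = B1 := by rw [← mul_assoc, this, one_mul]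
  set E : Matrix V W ℝ := Matrix.of fun a b => if S a ∧ b = q then 1 else 0 with hE
  have hEz : ∀ a b, b ≠ q → E a b = 0 := by
    intro a b hb; simp [hE, hb]
  have hz : E * B2 * Eᵀ = 0 := by
    ext a a'
    rw [Matrix.mul_apply, Finset.sum_eq_single q, Matrix.mul_apply, Finset.sum_eq_single q]
    · simp [d2]
    · intro b _ hb; simp [hEz a b hb]
    · simp
    · intro b _ hb; simp [hEz a' b hb]
    · simp
  have hoff : ∀ u v, u ≠ v → (Eᵀ * B1 * E) u v = 0 := by
    intro u v huv
    by_cases hv : v = q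
    · have hu : u ≠ q := fun h => huv (h.trans hv.symm)
      rw [Matrix.mul_assoc, Matrix.mul_apply]
      exact Finset.sum_eq_zero fun k _ => by simp [hEz k u hu]
    · rw [Matrix.mul_apply]
      exact Finset.sum_eq_zero fun k _ => by simp [hEz k v hv]
  have hd : ∀ v, (B1 + B1 * (E * B2 * Eᵀ) * B1) v v = 0 := by
    intro v; simp [hz, d1]
  set M := Matrix.fromBlocks A1 E Eᵀ (A2 + Eᵀ * B1 * E) with hM
  set N := Matrix.fromBlocks B1 (-(B1 * E * B2)) (-(B2 * Eᵀ * B1)) B2 with hN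
  have hMN : M * N = 1 := by
    rw [hM, hN, Matrix.fromBlocks_multiply, ← Matrix.fromBlocks_one]
    congr 1
    · have : E * -(B2 * Eᵀ * B1) = -(E * B2 * Eᵀ * B1) := by
        simp only [Matrix.mul_neg, Matrix.mul_assoc]
      rw [this, hz, m1]; simp
    · rw [Matrix.mul_neg, ← Matrix.mul_assoc, ← Matrix.mul_assoc, m1, Matrix.one_mul]; simp
    · have : (A2 + Eᵀ * B1 * E) * -(B2 * Eᵀ * B1)
          = -(A2 * B2 * (Eᵀ * B1)) - Eᵀ * B1 * (E * B2 * Eᵀ) * B1 := by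
        simp only [Matrix.mul_neg, Matrix.add_mul, Matrix.mul_assoc]; abel
      rw [this, hz, m2]; simp
    · have : Eᵀ * -(B1 * E * B2) + (A2 + Eᵀ * B1 * E) * B2 = A2 * B2 := by
        simp only [Matrix.mul_neg, Matrix.add_mul, Matrix.mul_assoc]; abel
      rw [this, m2]
  have hMs : M.IsSymm := by
    rw [hM]
    apply Matrix.IsSymm.fromBlocks s1 rfl
    show _ᵀ = _
    rw [Matrix.transpose_add, s2.eq, Matrix.transpose_mul, Matrix.transpose_mul, sB1,
      Matrix.transpose_transpose, Matrix.mul_assoc]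
  have hEp : ∀ a b, E a b ≠ 0 ↔ S a ∧ b = q := by
    intro a b; simp [hE]
  refine ⟨M.submatrix e.symm e.symm, N.submatrix e.symm e.symm, hMs.submatrix _, ?_, ?_, ?_⟩
  · intro u v huv
    obtain ⟨u, rfl⟩ := e.surjective u
    obtain ⟨v, rfl⟩ := e.surjective v
    have huv' : u ≠ v := fun h => huv (by rw [h])
    rw [Matrix.submatrix_apply, e.symm_apply_apply, e.symm_apply_apply]
    rcases u with u | u <;> rcases v with v | v
    · rw [h1, hM, Matrix.fromBlocks_apply₁₁]
      exact p1 u v fun h => huv' (by rw [h])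
    · rw [h3, hM, Matrix.fromBlocks_apply₁₂]; exact hEp u v
    · rw [K.adj_comm, h3, hM, Matrix.fromBlocks_apply₂₁]; exact hEp v u
    · have hne : u ≠ v := fun h => huv' (by rw [h])
      rw [h2, hM, Matrix.fromBlocks_apply₂₂, Matrix.add_apply, hoff u v hne, add_zero]
      exact p2 u v hne
  · rw [Matrix.submatrix_mul_equiv, hMN, Matrix.submatrix_one_equiv]
  · intro v
    rw [Matrix.submatrix_apply]
    rcases e.symm v with w | w
    · exact d1 w
    · exact d2 w

lemma qprop_complete (m : ℕ) (hm : 2 ≤ m) : QProp (⊤ : SimpleGraph (Fin m)) := by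
  have hm' : (m : ℝ) - 1 ≠ 0 := by
    have : (2 : ℝ) ≤ m := by exact_mod_cast hm
    linarith
  refine ⟨Matrix.of fun i j => 1 / ((m : ℝ) - 1) - if i = j then 1 else 0,
    Matrix.of fun i j => 1 - if i = j then 1 else 0, ?_, ?_, ?_, ?_⟩
  · ext i j; simp [eq_comm]
  · intro u v huv
    simp [huv, hm']
  · ext i j
    simp only [Matrix.mul_apply, Matrix.of_apply, sub_mul, mul_sub, Finset.sum_sub_distrib,
      Matrix.one_apply]
    simp
    field_simp
    ring
  · intro v; simp

/-- The path graph on `Fin n`. -/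
def pathG (n : ℕ) : SimpleGraph (Fin n) where
  Adj a b := (a : ℕ) + 1 = b ∨ (b : ℕ) + 1 = a
  symm := ⟨fun _ _ h => h.symm⟩
  loopless := ⟨fun _ h => by omega⟩

lemma qprop_path (k : ℕ) : QProp (pathG (k + k)) := by
  induction k with
  | zero =>
    exact ⟨0, 0, by ext i; exact i.elim0, fun u => u.elim0, by ext i; exact i.elim0,
      fun u => u.elim0⟩
  | succ k ih =>
    have e : k + 1 + (k + 1) = k + k + 2 := by ring
    rw [e]
    refine ih.join (qprop_complete 2 le_rfl) (fun a => (a : ℕ) + 1 = k + k) 0 finSumFinEquiv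
      ?_ ?_ ?_
    · intro a b; simp [pathG]
    · intro a b; fin_cases a <;> fin_cases b <;> simp [pathG] <;> omega
    · intro a b
      have := a.2
      fin_cases b <;> simp [pathG] <;> omega

lemma lol_ll (m n : ℕ) (a b : Fin m) : (lollipop m n).Adj (.inl a) (.inl b) ↔ a ≠ b := by
  simp [lollipop]; tauto

lemma lol_rr (m n : ℕ) (a b : Fin n) :
    (lollipop m n).Adj (.inr a) (.inr b) ↔ (pathG n).Adj a b := by
  constructor
  · rintro ⟨-, (⟨x, y, -, h, -⟩ | ⟨x, y, h, hx, hy⟩ | ⟨_, _, h, -⟩) |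
      (⟨x, y, -, h, -⟩ | ⟨x, y, h, hx, hy⟩ | ⟨_, _, h, -⟩)⟩
    · cases h
    · cases hx; cases hy; exact Or.inl h.symm
    · cases h
    · cases h
    · cases hx; cases hy; exact Or.inr h.symm
    · cases h
  · intro h
    refine ⟨fun hab => (pathG n).ne_of_adj h (Sum.inr_injective hab), ?_⟩
    rcases h with h | h
    · exact Or.inl (Or.inr (Or.inl ⟨a, b, h.symm, rfl, rfl⟩))
    · exact Or.inr (Or.inr (Or.inl ⟨b, a, h.symm, rfl, rfl⟩))

lemma lol_lr (m n : ℕ) (a : Fin m) (b : Fin n) :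
    (lollipop m n).Adj (.inl a) (.inr b) ↔ (a : ℕ) = 0 ∧ (b : ℕ) = 0 := by
  have := a.2
  have := b.2
  simp [lollipop, Fin.ext_iff]; omega

lemma lol_even (m n : ℕ) (hm : 2 ≤ m) (hn : 1 ≤ n) (h : Even n) : QProp (lollipop m n) := by
  obtain ⟨k, rfl⟩ := h
  refine (qprop_complete m hm).join (qprop_path k) (fun a => (a : ℕ) = 0) ⟨0, hn⟩
    (Equiv.refl _) ?_ ?_ ?_
  · intro a b; simp [lol_ll]
  · intro a b; simp [lol_rr]
  · intro a b; simp [lol_lr, Fin.ext_iff]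

lemma lol_odd (m n : ℕ) (hm : 2 ≤ m) (h : Even (n + 1)) : QProp (lollipop (m + 1) n) := by
  obtain ⟨k, hk⟩ := h
  have hp := qprop_path k
  rw [← hk] at hp
  let f : Fin m ⊕ Fin (n + 1) → Fin (m + 1) ⊕ Fin n :=
    Sum.elim (fun i => .inl i.succ) (Fin.cases (.inl 0) .inr)
  have hf : Function.Bijective f := by
    constructor
    · rintro (a | a) (b | b) hab
      · simpa [f] using hab
      · cases b using Fin.cases <;> simp [f] at hab
      · cases a using Fin.cases <;> simp [f] at hab
        exact absurd hab.symm (Fin.succ_ne_zero _)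
      · cases a using Fin.cases <;> cases b using Fin.cases <;> simp [f] at hab ⊢
        exact hab
    · rintro (a | a)
      · cases a using Fin.cases with
        | zero => exact ⟨.inr 0, rfl⟩
        | succ i => exact ⟨.inl i, rfl⟩
      · exact ⟨.inr a.succ, rfl⟩
  refine (qprop_complete m hm).join hp (fun _ => True) 0 (Equiv.ofBijective f hf) ?_ ?_ ?_
  · intro a b; simp [f, lol_ll]
  · intro a b
    cases a using Fin.cases <;> cases b using Fin.cases
    · simp [f]
    · simp [f, lol_lr, pathG]
    · simp [f, SimpleGraph.adj_comm _ (Sum.inr _) (Sum.inl _), lol_lr, pathG]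
    · simp [f, lol_rr, pathG]
  · intro a b
    cases b using Fin.cases
    · simp [f, lol_ll]
    · simp [f, lol_lr]

/-- For `m, n ≥ 1`, if either (`m > 1` and `n` is even) or `m > 2`, then the lollipop
graph `L(m,n)` has property (P). -/
theorem stmt_15 (m n : ℕ) (hm : 1 ≤ m) (hn : 1 ≤ n)
    (h : (1 < m ∧ Even n) ∨ 2 < m) :
    HasPropertyP (lollipop m n) := by
  apply QProp.hasPropertyP
  rcases Nat.even_or_odd n with he | ho
  · exact lol_even m n (by omega) hn he
  · have h2 : 2 < m := by
      rcases h with h | h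
      · exact absurd h.2 (Nat.not_even_iff_odd.mpr ho)
      · exact h
    obtain ⟨k, rfl⟩ : ∃ k, m = k + 1 := ⟨m - 1, by omega⟩
    exact lol_odd k n (by omega) ho.add_one
end

section
/- For every natural number n ≥ 1, the n-barbell graph B(n) has property (P). -/
open Matrix SimpleGraph

/-- The `n`-barbell graph `B(n)` on `Fin n ⊕ Fin n`: two copies of the complete graph
`K_n`, with a single bridge joining `inl 0` to `inr 0`. -/
def barbell (n : ℕ) : SimpleGraph (Fin n ⊕ Fin n) :=
  SimpleGraph.fromRel fun x y =>
    (∃ a b : Fin n, a ≠ b ∧ x = Sum.inl a ∧ y = Sum.inl b) ∨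
    (∃ a b : Fin n, a ≠ b ∧ x = Sum.inr a ∧ y = Sum.inr b) ∨
    (∃ (h : 0 < n), x = Sum.inl ⟨0, h⟩ ∧ y = Sum.inr ⟨0, h⟩)

/-- If `A * B = 1` and `B` has a zero diagonal entry at `v`, then `A(v)` is singular. -/
lemma det_delete_eq_zero {V : Type*} [Fintype V] [DecidableEq V] (A B : Matrix V V ℝ)
    (h : A * B = 1) (v : V) (hv : B v v = 0) :
    (A.submatrix (fun x : {x : V // x ≠ v} => (x : V))
        (fun x : {x : V // x ≠ v} => (x : V))).det = 0 := by
  have key : ∀ u : V, ∑ x : {x : V // x ≠ v}, A u x * B x v = (1 : Matrix V V ℝ) u v := by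
    intro u
    have h2 := Finset.sum_subtype (p := fun x => x ≠ v) (F := inferInstance) (Finset.univ.erase v) (by simp)
      (fun x => A u x * B x v)
    rw [← h, Matrix.mul_apply, ← Finset.sum_erase Finset.univ (a := v) (by simp [hv]), h2]
  rw [← Matrix.exists_mulVec_eq_zero_iff]
  refine ⟨fun x => B x v, ?_, ?_⟩
  · intro h0
    have h1 := key v
    rw [Finset.sum_eq_zero] at h1
    · simp at h1
    · intro x _
      have := congrFun h0 x
      simp only [Pi.zero_apply] at this
      simp [this]
  · ext u
    have := key u
    rw [Matrix.one_apply_ne u.2] at this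
    simpa [Matrix.mulVec, dotProduct] using this

lemma propP_of_blocks (m : ℕ) (M E P Q : Matrix (Fin (m+1)) (Fin (m+1)) ℝ)
    (hM : M.IsSymm) (hE : E.IsSymm) (hM0 : ∀ a b, a ≠ b → M a b ≠ 0)
    (hE0 : ∀ a b, E a b ≠ 0 ↔ a = 0 ∧ b = 0)
    (h1 : M * P + E * Q = 1) (h2 : M * Q + E * P = 0)
    (hP : ∀ a, P a a = 0) : HasPropertyP (barbell (m+1)) := by
  unfold HasPropertyP
  have hAB : fromBlocks M E E M * fromBlocks P Q Q P = 1 := by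
    rw [Matrix.fromBlocks_multiply, h1, h2, add_comm (E * P), h2, add_comm (E * Q), h1] 
    ext (i | i) (j | j) <;> simp [Matrix.one_apply]
  refine ⟨fromBlocks M E E M, ?_, ?_, ?_, ?_⟩
  · exact Matrix.IsSymm.fromBlocks hM hE hM
  · have hz : (⟨0, Nat.succ_pos m⟩ : Fin (m+1)) = 0 := rfl
    rintro (a | a) (b | b) hab
    · have : a ≠ b := fun h => hab (by rw [h])
      simp [barbell, hM0 a b this, this]
    · simp only [fromBlocks_apply₁₂, hE0]
      simp [barbell]
    · simp only [fromBlocks_apply₂₁, hE0]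
      simp [barbell, and_comm]
    · have : a ≠ b := fun h => hab (by rw [h])
      simp [barbell, hM0 a b this, this]
  · have h3 : (fromBlocks M E E M).det ≠ 0 := by
      intro h0
      have := congrArg Matrix.det hAB
      rw [Matrix.det_mul, h0] at this
      simp at this
    convert h3
  · intro v
    have := det_delete_eq_zero (fromBlocks M E E M) (fromBlocks P Q Q P) (by convert hAB) v
      (by rcases v with a | a <;> simp [hP])
    convert this

/-- For every `n ≥ 1`, the `n`-barbell graph has property (P). -/
theorem stmt_16 (n : ℕ) (hn : 1 ≤ n) : HasPropertyP (barbell n) := by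
  obtain ⟨m, rfl⟩ : ∃ m, n = m + 1 := ⟨n - 1, by omega⟩
  rcases Nat.eq_zero_or_pos m with rfl | hm
  · refine propP_of_blocks 0 0 1 0 1 (by simp [Matrix.IsSymm]) (by simp [Matrix.IsSymm]) ?_ ?_
      (by simp) (by simp) (by simp)
    · intro a b h
      exact absurd (by omega) h
    · intro a b
      have ha : a = 0 := by omega
      have hb : b = 0 := by omega
      subst ha hb
      simp
  · have hm' : (m : ℝ) ≠ 0 := by exact_mod_cast hm.ne'
    let J : Matrix (Fin (m+1)) (Fin (m+1)) ℝ := Matrix.of fun _ _ => 1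
    let E : Matrix (Fin (m+1)) (Fin (m+1)) ℝ := Matrix.single 0 0 1
    let M := J - (m : ℝ) • (1 : Matrix (Fin (m+1)) (Fin (m+1)) ℝ)
    let P := (m : ℝ)⁻¹ • (J - 1)
    have hJ : J * J = ((m : ℝ) + 1) • J := by
      ext i j
      simp [J, Matrix.mul_apply]
    have hMP : M * P = 1 := by
      simp only [M, P, Matrix.mul_smul, Matrix.sub_mul, Matrix.mul_sub, hJ, Matrix.smul_mul,
        Matrix.mul_one, Matrix.one_mul]
      ext i j
      simp only [Matrix.smul_apply, Matrix.sub_apply, smul_eq_mul]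
      field_simp
      ring
    have hEPE : E * P * E = 0 := by
      simp [E, P, J]
    refine propP_of_blocks m M E P (-(P * E * P)) ?_ ?_ ?_ ?_ ?_ ?_ ?_
    · ext i j
      simp [M, J, Matrix.one_apply, eq_comm]
    · simp [E, Matrix.IsSymm]
    · intro a b h
      simp [M, J, h]
    · intro a b
      simp [E, Matrix.single_apply, eq_comm]
    · rw [hMP, Matrix.mul_neg, ← Matrix.mul_assoc, ← Matrix.mul_assoc, hEPE]
      simp
    · rw [Matrix.mul_neg, ← Matrix.mul_assoc, ← Matrix.mul_assoc, hMP]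
      simp
    · intro a
      simp [P, J]
end

section
/- Let G be a connected tree–cycle block graph on a finite vertex set and let t > 1. Then the corona product G ∘ K_t has property (P). -/
open Matrix SimpleGraph

/-- A finite simple graph `H` is a tree–cycle block graph if, after deleting all bridges,
every connected component either is a single vertex, or has at least 3 vertices and its
induced subgraph is connected with every vertex of degree exactly 2 (i.e. it is a cycle). -/
def IsTreeCycleBlock {ι : Type*} (H : SimpleGraph ι) : Prop :=
  ∀ C : (H.deleteEdges {e : Sym2 ι | H.IsBridge e}).ConnectedComponent,
    (∃ v, C.supp = {v}) ∨
    (3 ≤ C.supp.ncard ∧ (H.induce C.supp).Connected ∧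
      ∀ v : C.supp, ((H.induce C.supp).neighborSet v).ncard = 2)

/-- The corona product `G ∘ K_t` on `V ⊕ (V × Fin t)`: `inl u ~ inl v` iff `u ~ v` in
`G`; `inr (u,i) ~ inr (v,j)` iff `u = v` and `i ≠ j`; and `inl u ~ inr (v,i)` iff
`u = v`. -/
def corona {V : Type*} (G : SimpleGraph V) (t : ℕ) : SimpleGraph (V ⊕ V × Fin t) :=
  SimpleGraph.fromRel fun x y =>
    (∃ u v : V, G.Adj u v ∧ x = Sum.inl u ∧ y = Sum.inl v) ∨
    (∃ (u : V) (i j : Fin t), i ≠ j ∧ x = Sum.inr (u, i) ∧ y = Sum.inr (u, j)) ∨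
    (∃ (u : V) (i : Fin t), x = Sum.inl u ∧ y = Sum.inr (u, i))

/-- A matrix with the pattern of `G` and an inverse with zero diagonal witnesses (P). -/
theorem hasPropertyP_of_inverse {W : Type*} [Finite W]
    (G : SimpleGraph W) (A Z : Matrix W W ℝ) (hs : A.IsSymm)
    (hp : ∀ u v : W, u ≠ v → (A u v ≠ 0 ↔ G.Adj u v))
    (hAZ : ∀ [Fintype W] [DecidableEq W], A * Z = 1) (hZ : ∀ v, Z v v = 0) : HasPropertyP G := by
  letI : Fintype W := Fintype.ofFinite W
  letI : DecidableEq W := Classical.decEq W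
  replace hAZ : A * Z = 1 := hAZ
  refine ⟨A, hs, hp, ?_, ?_⟩
  · intro h
    have := congrArg Matrix.det hAZ
    rw [Matrix.det_mul, h, zero_mul, Matrix.det_one] at this
    exact zero_ne_one this
  · intro v
    have hsum : ∀ x, ∑ y : {y : W // y ≠ v}, A x y * Z y v = (1 : Matrix W W ℝ) x v := by
      intro x
      rw [← hAZ, Matrix.mul_apply]
      rw [← Finset.sum_erase_add _ _ (Finset.mem_univ v), hZ, mul_zero, add_zero]
      exact (Finset.sum_subtype (p := fun y => y ≠ v) (Finset.univ.erase v) (by simp)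
        (fun y => A x y * Z y v)).symm
    rw [← Matrix.exists_mulVec_eq_zero_iff]
    refine ⟨fun y => Z y v, ?_, ?_⟩
    · intro h0
      have h3 := hsum v
      rw [Matrix.one_apply_eq, Finset.sum_eq_zero] at h3
      · exact zero_ne_one h3
      · intro y _
        have : Z y v = 0 := congrFun h0 y
        rw [this, mul_zero]
    · ext x
      have h3 := hsum x
      rw [Matrix.one_apply_ne x.2] at h3
      simpa [Matrix.mulVec, dotProduct] using h3

open Classical in
/-- The witnessing matrix. -/
noncomputable def coronaMat {V : Type*} (G : SimpleGraph V) (t : ℕ) :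
    Matrix (V ⊕ V × Fin t) (V ⊕ V × Fin t) ℝ
  | .inl u, .inl v => (if u = v then 1 / (t : ℝ) - 1 else 0) + (if G.Adj u v then 1 else 0)
  | .inl u, .inr (v, _) => if u = v then 1 / (t : ℝ) else 0
  | .inr (u, _), .inl v => if u = v then 1 / (t : ℝ) else 0
  | .inr (u, i), .inr (v, j) => if u = v then 1 / (t : ℝ) - (if i = j then 1 else 0) else 0

open Classical in
/-- Its inverse. -/
noncomputable def coronaInv {V : Type*} (G : SimpleGraph V) (t : ℕ) :
    Matrix (V ⊕ V × Fin t) (V ⊕ V × Fin t) ℝ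
  | .inl _, .inl _ => 0
  | .inl u, .inr (v, _) => if u = v then 1 else 0
  | .inr (u, _), .inl v => if u = v then 1 else 0
  | .inr (u, i), .inr (v, j) =>
      (if u = v then 1 - (if i = j then 1 else 0) else 0) - (if G.Adj u v then 1 else 0)

/-- If `G` is a connected tree–cycle block graph on a finite vertex set and `t > 1`,
then the corona product `G ∘ K_t` has property (P). -/
theorem stmt_17 {V : Type*} [Finite V] (G : SimpleGraph V)
    (hconn : G.Connected) (htcb : IsTreeCycleBlock G) (t : ℕ) (ht : 1 < t) :
    HasPropertyP (corona G t) := by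
  classical
  haveI : Fintype V := Fintype.ofFinite V
  have ht0 : (t : ℝ) ≠ 0 := by
    have : t ≠ 0 := by omega
    exact_mod_cast this
  refine hasPropertyP_of_inverse (corona G t) (coronaMat G t) (coronaInv G t) ?_ ?_ ?_ ?_
  · ext x y
    rcases x with u | ⟨u, i⟩ <;> rcases y with v | ⟨v, j⟩ <;>
      simp [coronaMat, Matrix.transpose_apply, eq_comm, G.adj_comm]
  · intro x y hxy
    rcases x with u | ⟨u, i⟩ <;> rcases y with v | ⟨v, j⟩
    · have huv : u ≠ v := fun h => hxy (by rw [h])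
      simp [coronaMat, corona, SimpleGraph.fromRel_adj, huv, G.adj_comm]
    · by_cases huv : u = v <;>
        simp [coronaMat, corona, SimpleGraph.fromRel_adj, huv, ht0, eq_comm]
    · by_cases huv : u = v <;>
        simp [coronaMat, corona, SimpleGraph.fromRel_adj, huv, ht0, eq_comm]
    · by_cases huv : u = v
      · subst huv
        have hij : i ≠ j := fun h => hxy (by rw [h])
        simp [coronaMat, corona, SimpleGraph.fromRel_adj, hij, ht0, Ne.symm hij]
      · simp [coronaMat, corona, SimpleGraph.fromRel_adj, huv, Ne.symm huv]
        try grind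
  · intro iF iD
    have h1 : iF = instFintypeSum V (V × Fin t) := Subsingleton.elim _ _
    subst h1
    ext x y
    rw [Matrix.mul_apply, Fintype.sum_sum_type, Fintype.sum_prod_type]
    rcases x with u | ⟨u, i⟩ <;> rcases y with v | ⟨v, j⟩
    · by_cases huv : u = v <;>
        simp [coronaMat, coronaInv, huv, ht0, Finset.sum_ite_irrel, Matrix.one_apply]
    · by_cases huv : u = v
      · subst huv
        simp [coronaMat, coronaInv, Finset.sum_ite_irrel, Finset.sum_sub_distrib, ← Finset.mul_sum]
        field_simp
        ring
      · simp [coronaMat, coronaInv, huv, ht0, Finset.sum_ite_irrel]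
    · by_cases huv : u = v <;>
        simp [coronaMat, coronaInv, huv, ht0, Finset.sum_ite_irrel, Finset.sum_sub_distrib]
    · by_cases huv : u = v
      · subst huv
        simp [coronaMat, coronaInv, Finset.sum_ite_irrel, Finset.sum_sub_distrib, sub_mul, mul_sub,
          Matrix.one_apply, ht0]
      · simp [coronaMat, coronaInv, huv, ht0, Finset.sum_ite_irrel, Finset.sum_sub_distrib, sub_mul]
  · intro x
    rcases x with u | ⟨u, i⟩ <;> simp [coronaInv]
end
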